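/- arXiv:1106.0051 — 3 statements merged into one kernel-verified Lean document; each statement's English description precedes it below -/
import Mathlib

section
/- (Spectral gap.) Assume (F0), (F1), (F2), (F01) and (F012). Then every pair (p,ξ) with p∈[0,1], ξ:ℕ→{0,1,2} and (p,ξ) ∉ E satisfies χ̄(p,ξ) ≤ log β'. Consequently χ̃ := sup{χ̄(p,ξ) : (p,ξ) ∉ E} satisfies 0 < χ̃ < log β⁻. -/
open Set Filter MeasureTheory

noncomputable section

/-- Condition (F0) on the fiber map `f₀`. -/
def F0cond (f₀ : ℝ → ℝ) (β₀ lam₀ : ℝ) : Prop :=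
  ContDiff ℝ 1 f₀ ∧ Set.MapsTo f₀ (Set.Icc 0 1) (Set.Icc 0 1) ∧
  StrictMonoOn f₀ (Set.Icc 0 1) ∧ f₀ 0 = 0 ∧ f₀ 1 = 1 ∧
  (∀ x ∈ Set.Ioo (0:ℝ) 1, x < f₀ x) ∧
  deriv f₀ 0 = β₀ ∧ 1 < β₀ ∧ deriv f₀ 1 = lam₀ ∧ 0 < lam₀ ∧ lam₀ < 1 ∧
  (∀ x ∈ Set.Icc (0:ℝ) 1, lam₀ ≤ deriv f₀ x)

/-- Condition (F1) on the fiber map `f₁`. -/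
def F1cond (f₁ : ℝ → ℝ) (γ lam₀ : ℝ) : Prop :=
  (∀ x, f₁ x = γ * (1 - x)) ∧ lam₀ ≤ γ ∧ γ < 1

/-- Condition (F2) on the fiber map `f₂`. -/
def F2cond (f₂ : ℝ → ℝ) (β₂ lam₀ : ℝ) : Prop :=
  ContDiff ℝ 1 f₂ ∧ Set.MapsTo f₂ (Set.Icc 0 1) (Set.Icc 0 1) ∧
  StrictMonoOn f₂ (Set.Icc 0 1) ∧ f₂ 0 = 0 ∧
  deriv f₂ 0 = β₂ ∧ 1 < β₂ ∧ (∀ x ∈ Set.Icc (0:ℝ) 1, lam₀ ≤ deriv f₂ x) ∧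
  ∃ p₂, p₂ ∈ Set.Ioo (0:ℝ) 1 ∧ f₂ p₂ = p₂ ∧ (∀ x ∈ Set.Ioo 0 p₂, x < f₂ x) ∧
    (∀ x ∈ Set.Ioc p₂ 1, f₂ x < x)

/-- Condition (F01). -/
def F01cond (f₀ : ℝ → ℝ) (β₀ lam₀ γ : ℝ) : Prop :=
  AntitoneOn (deriv f₀) (Set.Icc 0 1) ∧
  1 < γ * (lam₀ ^ 3 * (1 - lam₀) / (1 - β₀⁻¹))

/-- Condition (F012), with `H = [0,δ]`, `H' = [1-γ⁻¹δ,1]`, and the derived constants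
`β' = βpr`, `β_H = βH`, `λ' = lampr`, `L`. -/
def F012cond (f₀ f₁ f₂ : ℝ → ℝ) (γ lam₀ β₀ β₂ δ βpr βH lampr : ℝ) (L : ℕ) : Prop :=
  (∀ x ∈ Set.Icc (0:ℝ) 1, deriv f₀ x ≤ max β₀ β₂ ∧ deriv f₂ x ≤ max β₀ β₂) ∧
  0 < δ ∧ δ < γ ∧
  (f₁ '' Set.Icc 0 δ) ∩ Set.Icc 0 δ = ∅ ∧
  (f₁ '' Set.Icc (1 - γ⁻¹ * δ) 1) ∩ Set.Icc (1 - γ⁻¹ * δ) 1 = ∅ ∧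
  (f₁ '' Set.Icc 0 1) ∩ Set.Icc (1 - γ⁻¹ * δ) 1 = ∅ ∧
  (f₂ '' Set.Icc 0 1) ∩ Set.Icc (1 - γ⁻¹ * δ) 1 = ∅ ∧
  IsGreatest {y | ∃ x ∈ Set.Icc δ 1, y = max (deriv f₀ x) (deriv f₂ x)} βpr ∧
  1 < βpr ∧ βpr < min β₀ β₂ ∧
  IsLeast {y | ∃ x ∈ Set.Icc (0:ℝ) δ, y = min (deriv f₀ x) (deriv f₂ x)} βH ∧
  1 < βH ∧ βH < min β₀ β₂ ∧
  IsGreatest {y | ∃ x ∈ Set.Icc (1 - γ⁻¹ * δ) 1, y = deriv f₀ x} lampr ∧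
  lampr < 1 ∧
  |Real.log lam₀| * Real.log (max β₀ β₂) / Real.log βH - |Real.log lampr|
      + (2 / 3) * Real.log (max β₀ β₂) < (3 / 4) * Real.log βpr ∧
  1 ≤ L ∧
  4 * |Real.log lam₀| * Real.log (max β₀ β₂) / (Real.log βH * Real.log βpr) < (L : ℝ) ∧
  Real.log ((max β₀ β₂) ^ L * γ) / ((L : ℝ) + 1) < Real.log βpr

/-- `f_{ξ_{n-1}} ∘ ⋯ ∘ f_{ξ₀}`. -/
def seqComp (fs : Fin 3 → ℝ → ℝ) (ξ : ℕ → Fin 3) : ℕ → ℝ → ℝ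
  | 0 => id
  | n + 1 => fun x => fs (ξ n) (seqComp fs ξ n x)

/-- The upper Lyapunov exponent of the point `p` under the itinerary `ξ`. -/
def lyapUpper (fs : Fin 3 → ℝ → ℝ) (p : ℝ) (ξ : ℕ → Fin 3) : ℝ :=
  Filter.limsup (fun n : ℕ => (1 / (n : ℝ)) * Real.log |deriv (seqComp fs ξ n) p|) Filter.atTop

/-- Membership in the exceptional set `E`. -/
def exceptional (fs : Fin 3 → ℝ → ℝ) (p : ℝ) (ξ : ℕ → Fin 3) : Prop :=
  ∃ m : ℕ, seqComp fs ξ m p = 0 ∧ ∀ j, m ≤ j → (ξ j = 0 ∨ ξ j = 2)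

/-- `f_[w] = f_{w_{m-1}} ∘ ⋯ ∘ f_{w₀}` for a finite word `w`. -/
def wordComp {α : Type*} (fs : α → ℝ → ℝ) (w : List α) : ℝ → ℝ :=
  fun x => w.foldl (fun y i => fs i y) x

/-- The two-sided sequence space `Σ₃`. -/
abbrev Sig3 := ℤ → Fin 3

/-- The state space `Σ₃ × [0,1]`. -/
abbrev XSp := Sig3 × (Set.Icc (0:ℝ) 1)

instance : UniformSpace (Fin 3) := ⊥

/-- The left shift on `Σ₃`. -/
def shiftMap (ξ : Sig3) : Sig3 := fun i => ξ (i + 1)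

/-- The step skew product `G(ξ,x) = (σξ, f_{ξ₀}(x))` on `Σ₃ × [0,1]`. -/
def Gmap (fs : Fin 3 → ℝ → ℝ) : XSp → XSp :=
  fun p => (shiftMap p.1, Set.projIcc 0 1 (by norm_num) (fs (p.1 0) (p.2 : ℝ)))

/-- The maximal invariant set `Λ_G = ⋂ₙ Gⁿ(Σ₃ × [0,1])`. -/
def LamG (fs : Fin 3 → ℝ → ℝ) : Set XSp := ⋂ n : ℕ, (Gmap fs)^[n] '' Set.univ

/-- The lateral horseshoe `Λ₀₂`. -/
def Lam02 : Set XSp := {p | (∀ i, p.1 i ≠ 1) ∧ (p.2 : ℝ) = 0}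

/-- The central derivative potential `φ(ξ,x) = log|f_{ξ₀}'(x)|`. -/
def phiC (fs : Fin 3 → ℝ → ℝ) (p : XSp) : ℝ := Real.log |deriv (fs (p.1 0)) (p.2 : ℝ)|

/-- The central Lyapunov exponent `χ(μ) = ∫ φ dμ` of a measure. -/
def chiOf (fs : Fin 3 → ℝ → ℝ) (μ : Measure XSp) : ℝ := ∫ p, phiC fs p ∂μ

/-- `ν` is the `(p 0, p 1, p 2)`-Bernoulli measure on `Σ₃`. -/
def IsBernoulli (p : Fin 3 → ℝ) (ν : Measure Sig3) : Prop :=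
  IsProbabilityMeasure ν ∧ ∀ (s : Finset ℤ) (a : ℤ → Fin 3),
    ν {ξ | ∀ i ∈ s, ξ i = a i} = ENNReal.ofReal (∏ i ∈ s, p (a i))


/-- facts derived from the hypotheses -/
structure Facts (f₀ f₁ f₂ : ℝ → ℝ) (γ lam δ h bH b B lp Q l : ℝ) (L : ℕ) : Prop where
  hγ : 0 < γ
  hγ1 : γ < 1
  hlam : 0 < lam
  hlam1 : lam < 1
  hlγ : lam ≤ γ
  hδ : 0 < δ
  hδh : δ < h
  hh1 : h < 1
  hh : ∀ x, h ≤ x ↔ γ * (1 - x) ≤ δ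
  hf1 : ∀ x, f₁ x = γ * (1 - x)
  hγh : γ < h
  f00 : f₀ 0 = 0
  f01 : f₀ 1 = 1
  f20 : f₂ 0 = 0
  m0 : StrictMonoOn f₀ (Set.Icc 0 1)
  m2 : StrictMonoOn f₂ (Set.Icc 0 1)
  inc0 : ∀ x ∈ Set.Ioo (0:ℝ) 1, x < f₀ x
  im2 : ∀ x ∈ Set.Icc (0:ℝ) 1, f₂ x < h
  l0 : ∀ x ∈ Set.Icc (0:ℝ) 1, lam ≤ deriv f₀ x
  l2 : ∀ x ∈ Set.Icc (0:ℝ) 1, lam ≤ deriv f₂ x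
  B0 : ∀ x ∈ Set.Icc (0:ℝ) 1, Real.log |deriv f₀ x| ≤ B
  B2 : ∀ x ∈ Set.Icc (0:ℝ) 1, Real.log |deriv f₂ x| ≤ B
  b0 : ∀ x ∈ Set.Icc δ 1, Real.log |deriv f₀ x| ≤ b
  b2 : ∀ x ∈ Set.Icc δ 1, Real.log |deriv f₂ x| ≤ b
  lp0 : ∀ x ∈ Set.Icc h 1, Real.log |deriv f₀ x| ≤ lp
  d1 : ∀ x, Real.log |deriv f₁ x| = Real.log γ
  c1 : ∀ x ∈ Set.Icc (0:ℝ) 1, lam * (1 - x) ≤ 1 - f₀ x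
  e0 : ∀ x ∈ Set.Icc (0:ℝ) δ, bH * x ≤ f₀ x
  e2 : ∀ x ∈ Set.Icc (0:ℝ) δ, bH * x ≤ f₂ x
  hbH : 1 < bH
  hb : 0 < b
  hbB : b < B
  hlp : lp < 0
  hl : l = - Real.log lam
  hQ : Q * Real.log bH = l * B
  hlQ : l ≤ Q
  hQ1 : Q + lp + 2 / 3 * B < 3 / 4 * b
  hL1 : 1 ≤ L
  hQL : 4 * Q < L * b
  hLB : L * B + Real.log γ < (L + 1) * b

theorem arith (B b Q lp G : ℝ) (L k M : ℕ) (hb : 0 < b) (hbB : b < B) (hG : G < 0) (hGQ : -G ≤ Q)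
    (hlp : lp < 0) (hQ1 : Q + lp + 2 / 3 * B < 3 / 4 * b) (hL1 : 1 ≤ L) (hQL : 4 * Q < L * b)
    (hLB : L * B + G < (L + 1) * b) (hM : ((M:ℝ) - 1) * B ≤ (k + 1) * Q) :
    M * B + k * lp + G ≤ (k + 1 + M) * b := by
  have hk : (0:ℝ) ≤ k := Nat.cast_nonneg k
  have hL : (1:ℝ) ≤ L := by exact_mod_cast hL1
  have hklp : k * lp ≤ 0 := mul_nonpos_of_nonneg_of_nonpos hk hlp.le
  have hkb : 0 ≤ k * b := by positivity
  by_cases hML : M ≤ L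
  · have : (M:ℝ) ≤ L := by exact_mod_cast hML
    nlinarith [mul_nonneg (sub_nonneg.2 this) (sub_nonneg.2 hbB.le)]
  · have hM' : (L:ℝ) + 1 ≤ M := by exact_mod_cast (not_le.1 hML)
    have h1 : k * (Q + lp) ≤ k * b := by
      apply mul_le_mul_of_nonneg_left _ hk
      linarith
    have hB : B ≤ 9 / 4 * b := by
      have : (L:ℝ) * B ≤ L * (9/4 * b) := by nlinarith
      exact le_of_mul_le_mul_left this (by linarith)
    have h2 : (L + 1) * b ≤ M * b := mul_le_mul_of_nonneg_right hM' hb.le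
    have h3 : b ≤ L * b := by nlinarith
    nlinarith

section
variable {f₀ f₁ f₂ : ℝ → ℝ} {γ lam δ h bH b B lp Q l : ℝ} {L : ℕ}

theorem Facts.arith' (F : Facts f₀ f₁ f₂ γ lam δ h bH b B lp Q l L) {k N M : ℕ}
    (hN : bH ^ N * (lam ^ (k + 1) * δ) ≤ δ) (hM : M ≤ N + 1) :
    M * B + k * lp + Real.log γ ≤ (k + 1 + M) * b := by
  have hlbH : 0 < Real.log bH := Real.log_pos F.hbH
  have hbH0 : 0 < bH := by linarith [F.hbH]
  have h1 : bH ^ N * lam ^ (k + 1) ≤ 1 := by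
    have : bH ^ N * lam ^ (k + 1) * δ ≤ 1 * δ := by linarith
    exact le_of_mul_le_mul_right this F.hδ
  have h2 : N * Real.log bH + (k + 1) * Real.log lam ≤ 0 := by
    have hp : 0 < bH ^ N * lam ^ (k + 1) := mul_pos (pow_pos hbH0 _) (pow_pos F.hlam _)
    have := Real.log_nonpos hp.le h1
    rw [Real.log_mul (pow_pos hbH0 _).ne' (pow_pos F.hlam _).ne', Real.log_pow, Real.log_pow] at this
    push_cast at this
    exact this
  have hB : 0 < B := F.hb.trans F.hbB
  have hl := F.hl
  have h3 : (N:ℝ) * B ≤ (k + 1) * Q := by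
    have : (N:ℝ) * B * Real.log bH ≤ (k + 1) * Q * Real.log bH := by
      calc (N:ℝ) * B * Real.log bH = (N * Real.log bH) * B := by ring
        _ ≤ ((k + 1) * l) * B := by
          apply mul_le_mul_of_nonneg_right _ hB.le
          rw [hl]; linarith
        _ = (k + 1) * (l * B) := by ring
        _ = _ := by rw [← F.hQ]; ring
    exact le_of_mul_le_mul_right this hlbH
  have hM' : (M:ℝ) ≤ N + 1 := by exact_mod_cast hM
  refine arith B b Q lp _ L k M F.hb F.hbB (Real.log_neg F.hγ F.hγ1) ?_ F.hlp F.hQ1 F.hL1 F.hQL F.hLB ?_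
  · have := Real.log_le_log F.hlam F.hlγ
    have := F.hlQ
    linarith
  · have : ((M:ℝ) - 1) * B ≤ N * B := mul_le_mul_of_nonneg_right (by linarith) hB.le
    linarith

theorem fin3_cases (i : Fin 3) : i = 0 ∨ i = 1 ∨ i = 2 := by
  fin_cases i <;> simp

theorem Facts.nf0 (F : Facts f₀ f₁ f₂ γ lam δ h bH b B lp Q l L) {x : ℝ} (hx : δ < x) (hx1 : x ≤ 1) :
    δ < f₀ x := by
  have h1 := F.e0 δ ⟨F.hδ.le, le_rfl⟩
  have h2 : f₀ δ < f₀ x := F.m0 ⟨F.hδ.le, by linarith⟩ ⟨by linarith [F.hδ], hx1⟩ hx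
  nlinarith [F.hbH, F.hδ]

theorem Facts.nf2 (F : Facts f₀ f₁ f₂ γ lam δ h bH b B lp Q l L) {x : ℝ} (hx : δ < x) (hx1 : x ≤ 1) :
    δ < f₂ x := by
  have h1 := F.e2 δ ⟨F.hδ.le, le_rfl⟩
  have h2 : f₂ δ < f₂ x := F.m2 ⟨F.hδ.le, by linarith⟩ ⟨by linarith [F.hδ], hx1⟩ hx
  nlinarith [F.hbH, F.hδ]

theorem Facts.core (F : Facts f₀ f₁ f₂ γ lam δ h bH b B lp Q l L) (x S : ℕ → ℝ) (ξ : ℕ → Fin 3)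
    (hx : ∀ n, x (n + 1) = (![f₀, f₁, f₂] : Fin 3 → ℝ → ℝ) (ξ n) (x n))
    (hS : ∀ n, S (n + 1) = S n + Real.log |deriv ((![f₀, f₁, f₂] : Fin 3 → ℝ → ℝ) (ξ n)) (x n)|)
    (hx0 : x 0 ∈ Set.Ioo (0:ℝ) 1) : ∃ C : ℝ, ∀ n : ℕ, S n ≤ n * b + C := by
  have hG : Real.log γ < 0 := Real.log_neg F.hγ F.hγ1
  have hb := F.hb
  have hδ := F.hδ
  have hδh := F.hδh
  have hh1 := F.hh1
  have hlp := F.hlp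
  obtain ⟨C, hC⟩ : ∃ C : ℝ, (S 0 ≤ (0:ℕ) * b + C ∧ δ < x 0 ∧ x 0 < h) ∨
      (h ≤ x 0 ∧ ∃ k : ℕ, S 0 ≤ ((0:ℕ) - k) * b + k * lp + C ∧ lam ^ (k+1) * δ ≤ γ * (1 - x 0)) ∨
      (x 0 ≤ δ ∧ ∃ k N : ℕ, S 0 ≤ ((0:ℕ) - k - 1 - N) * b + k * lp + Real.log γ + N * B + C ∧
        bH ^ N * (lam ^ (k+1) * δ) ≤ x 0) := by
    have key : ∀ y > 0, ∃ k : ℕ, lam ^ (k+1) * δ ≤ y := by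
      intro y hy
      obtain ⟨k, hk⟩ := exists_pow_lt_of_lt_one (div_pos hy hδ) F.hlam1
      refine ⟨k, ?_⟩
      have h1 : lam ^ (k+1) ≤ lam ^ k := pow_le_pow_of_le_one F.hlam.le F.hlam1.le (by omega)
      exact (le_div_iff₀ hδ).1 (h1.trans hk.le)
    by_cases h1 : h ≤ x 0
    · obtain ⟨k, hk⟩ := key (γ * (1 - x 0)) (mul_pos F.hγ (by linarith [hx0.2]))
      exact ⟨S 0 + k * b - k * lp, Or.inr (Or.inl ⟨h1, k, by push_cast; linarith, hk⟩)⟩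
    · by_cases h2 : x 0 ≤ δ
      · obtain ⟨k, hk⟩ := key (x 0) hx0.1
        exact ⟨S 0 + (k + 1) * b - k * lp - Real.log γ, Or.inr (Or.inr ⟨h2, k, 0, by push_cast; linarith, by simpa using hk⟩)⟩
      · exact ⟨S 0, Or.inl ⟨by simp, by linarith, by linarith⟩⟩
  refine ⟨C, ?_⟩
  suffices H : ∀ n : ℕ, x n ∈ Set.Ioo (0:ℝ) 1 ∧ S n ≤ n * b + C ∧ ((δ < x n ∧ x n < h) ∨
      (h ≤ x n ∧ ∃ k : ℕ, S n ≤ (n - k) * b + k * lp + C ∧ lam ^ (k+1) * δ ≤ γ * (1 - x n)) ∨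
      (x n ≤ δ ∧ ∃ k N : ℕ, S n ≤ (n - k - 1 - N) * b + k * lp + Real.log γ + N * B + C ∧
        bH ^ N * (lam ^ (k+1) * δ) ≤ x n)) from fun n => (H n).2.1
  have red : ∀ n : ℕ, (x n ∈ Set.Ioo (0:ℝ) 1 ∧ ((S n ≤ n * b + C ∧ δ < x n ∧ x n < h) ∨
      (h ≤ x n ∧ ∃ k : ℕ, S n ≤ (n - k) * b + k * lp + C ∧ lam ^ (k+1) * δ ≤ γ * (1 - x n)) ∨
      (x n ≤ δ ∧ ∃ k N : ℕ, S n ≤ (n - k - 1 - N) * b + k * lp + Real.log γ + N * B + C ∧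
        bH ^ N * (lam ^ (k+1) * δ) ≤ x n))) → 
      x n ∈ Set.Ioo (0:ℝ) 1 ∧ S n ≤ n * b + C ∧ ((δ < x n ∧ x n < h) ∨
      (h ≤ x n ∧ ∃ k : ℕ, S n ≤ (n - k) * b + k * lp + C ∧ lam ^ (k+1) * δ ≤ γ * (1 - x n)) ∨
      (x n ≤ δ ∧ ∃ k N : ℕ, S n ≤ (n - k - 1 - N) * b + k * lp + Real.log γ + N * B + C ∧
        bH ^ N * (lam ^ (k+1) * δ) ≤ x n)) := by
    rintro n ⟨h0, ⟨h1, h2⟩ | h1 | h1⟩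
    · exact ⟨h0, h1, Or.inl h2⟩
    · refine ⟨h0, ?_, Or.inr (Or.inl h1)⟩
      obtain ⟨_, k, hk, _⟩ := h1
      have : (0:ℝ) ≤ k := Nat.cast_nonneg k
      nlinarith
    · refine ⟨h0, ?_, Or.inr (Or.inr h1)⟩
      obtain ⟨h3, k, N, hk, h4⟩ := h1
      have := F.arith' (h4.trans h3) (M := N) (by omega)
      nlinarith
  intro n
  induction n with
  | zero => exact red 0 ⟨hx0, hC⟩
  | succ n ih =>
    apply red
    obtain ⟨⟨hx0, hx1⟩, hSn, hst⟩ := ih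
    have hxn := hx n
    have hSn1 := hS n
    have hI : x n ∈ Set.Icc (0:ℝ) 1 := ⟨hx0.le, hx1.le⟩
    rcases fin3_cases (ξ n) with e | e | e
    · -- symbol 0
      simp only [e, Matrix.cons_val_zero] at hxn hSn1
      have hinc := F.inc0 (x n) ⟨hx0, hx1⟩
      have hlt1 : f₀ (x n) < 1 := by
        have := F.m0 hI ⟨zero_le_one, le_rfl⟩ hx1
        rwa [F.f01] at this
      have hc := F.c1 (x n) hI
      refine ⟨⟨by linarith, by linarith⟩, ?_⟩
      -- not in H' before, not in H after
      have gen : S (n+1) ≤ (n+1:ℕ) * b + C → x n < h → δ < x (n+1) → 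
        ((S (n+1) ≤ (n+1:ℕ) * b + C ∧ δ < x (n+1) ∧ x (n+1) < h) ∨
        (h ≤ x (n+1) ∧ ∃ k : ℕ, S (n+1) ≤ ((n+1:ℕ) - k) * b + k * lp + C ∧
          lam ^ (k+1) * δ ≤ γ * (1 - x (n+1)))) := by
        intro g1 g2 g3
        by_cases g4 : x (n+1) < h
        · exact Or.inl ⟨g1, g3, g4⟩
        · refine Or.inr ⟨not_lt.1 g4, 0, by simpa using g1, ?_⟩
          have g5 : δ < γ * (1 - x n) := by
            by_contra hcon
            exact absurd ((F.hh _).2 (not_lt.1 hcon)) (not_le.2 g2)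
          rw [hxn]
          have g6 := mul_le_mul_of_nonneg_left hc F.hγ.le
          have g7 := mul_le_mul_of_nonneg_left g5.le F.hlam.le
          simp only [zero_add, pow_one]
          nlinarith
      rcases hst with ⟨h1, h2⟩ | ⟨h1, k, h2, h3⟩ | ⟨h1, k, N, h2, h3⟩
      · have ha := F.b0 (x n) ⟨h1.le, hx1.le⟩
        have hS' : S (n+1) ≤ (n+1:ℕ) * b + C := by push_cast; linarith
        rcases gen hS' h2 (by linarith) with g | g
        · exact Or.inl g
        · exact Or.inr (Or.inl g)
      · have ha := F.lp0 (x n) ⟨h1, hx1.le⟩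
        refine Or.inr (Or.inl ⟨by linarith, k + 1, by push_cast; linarith, ?_⟩)
        rw [hxn, pow_succ]
        have g6 := mul_le_mul_of_nonneg_left hc F.hγ.le
        have g7 := mul_le_mul_of_nonneg_left h3 F.hlam.le
        nlinarith
      · have ha := F.B0 (x n) hI
        have hS' : S (n+1) ≤ ((n+1:ℕ) - k - 1 - (N+1:ℕ)) * b + k * lp + Real.log γ + (N+1:ℕ) * B + C := by
          push_cast; linarith
        by_cases h4 : x (n+1) ≤ δ
        · refine Or.inr (Or.inr ⟨h4, k, N+1, hS', ?_⟩)
          have he := F.e0 (x n) ⟨hx0.le, h1⟩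
          have := mul_le_mul_of_nonneg_left h3 (by linarith [F.hbH] : 0 ≤ bH)
          rw [hxn, pow_succ]
          nlinarith
        · have h5 := F.arith' (h3.trans h1) (M := N + 1) le_rfl
          have hS'' : S (n+1) ≤ (n+1:ℕ) * b + C := by nlinarith
          rcases gen hS'' (by linarith) (by linarith) with g | g
          · exact Or.inl g
          · exact Or.inr (Or.inl g)
    · -- symbol 1
      simp only [e, Matrix.cons_val_one, Matrix.cons_val_zero] at hxn hSn1
      rw [F.d1] at hSn1
      rw [F.hf1] at hxn
      have hγh := F.hγh
      have hγ := F.hγ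
      have q1 : 0 < γ * (1 - x n) := mul_pos hγ (by linarith)
      have q2 : γ * (1 - x n) < γ := by nlinarith
      refine ⟨⟨by linarith, by linarith⟩, ?_⟩
      have hA : x n < h → (S (n+1) ≤ (n+1:ℕ) * b + C ∧ δ < x (n+1) ∧ x (n+1) < h) := by
        intro g
        refine ⟨by push_cast; linarith, ?_, by linarith⟩
        rw [hxn]
        by_contra hcon
        exact absurd ((F.hh _).2 (not_lt.1 hcon)) (not_le.2 g)
      rcases hst with ⟨h1, h2⟩ | ⟨h1, k, h2, h3⟩ | ⟨h1, k, N, h2, h3⟩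
      · exact Or.inl (hA h2)
      · refine Or.inr (Or.inr ⟨?_, k, 0, ?_, ?_⟩)
        · rw [hxn]; exact (F.hh _).1 h1
        · push_cast; linarith
        · simpa [hxn] using h3
      · exact Or.inl (hA (by linarith))
    · -- symbol 2
      simp only [e, Matrix.cons_val] at hxn hSn1
      have hpos : 0 < f₂ (x n) := by
        have := F.m2 ⟨le_rfl, zero_le_one⟩ hI hx0
        rwa [F.f20] at this
      have hlt := F.im2 (x n) hI
      refine ⟨⟨by linarith, by linarith⟩, ?_⟩
      have hA : δ < x n → (S (n+1) ≤ (n+1:ℕ) * b + C ∧ δ < x (n+1) ∧ x (n+1) < h) := by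
        intro g
        have := F.b2 (x n) ⟨g.le, hx1.le⟩
        have := F.nf2 g hx1.le
        exact ⟨by push_cast; linarith, by linarith, by linarith⟩
      rcases hst with ⟨h1, h2⟩ | ⟨h1, k, h2, h3⟩ | ⟨h1, k, N, h2, h3⟩
      · exact Or.inl (hA h1)
      · exact Or.inl (hA (by linarith))
      · have ha := F.B2 (x n) hI
        have hS' : S (n+1) ≤ ((n+1:ℕ) - k - 1 - (N+1:ℕ)) * b + k * lp + Real.log γ + (N+1:ℕ) * B + C := by
          push_cast; linarith
        by_cases h4 : x (n+1) ≤ δ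
        · refine Or.inr (Or.inr ⟨h4, k, N+1, hS', ?_⟩)
          have he := F.e2 (x n) ⟨hx0.le, h1⟩
          have := mul_le_mul_of_nonneg_left h3 (by linarith [F.hbH] : 0 ≤ bH)
          rw [hxn, pow_succ]
          nlinarith
        · have h5 := F.arith' (h3.trans h1) (M := N + 1) le_rfl
          have hS'' : S (n+1) ≤ (n+1:ℕ) * b + C := by nlinarith
          exact Or.inl ⟨hS'', by linarith, by linarith⟩

/-- orbits stay in the unit interval -/
theorem Facts.maps (F : Facts f₀ f₁ f₂ γ lam δ h bH b B lp Q l L) (i : Fin 3) {x : ℝ}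
    (hx : x ∈ Set.Icc (0:ℝ) 1) : (![f₀, f₁, f₂] : Fin 3 → ℝ → ℝ) i x ∈ Set.Icc (0:ℝ) 1 := by
  have o : (0:ℝ) ∈ Set.Icc (0:ℝ) 1 := ⟨le_rfl, zero_le_one⟩
  have o1 : (1:ℝ) ∈ Set.Icc (0:ℝ) 1 := ⟨zero_le_one, le_rfl⟩
  rcases fin3_cases i with e | e | e
  · subst e
    have a1 := F.m0.monotoneOn o hx hx.1
    have a2 := F.m0.monotoneOn hx o1 hx.2
    rw [F.f00] at a1
    rw [F.f01] at a2
    exact ⟨a1, a2⟩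
  · subst e
    simp only [Matrix.cons_val_one, Matrix.cons_val_zero]
    rw [F.hf1]
    exact ⟨mul_nonneg F.hγ.le (by linarith [hx.2]), by nlinarith [F.hγ, F.hγ1, hx.1, hx.2]⟩
  · subst e
    have a1 := F.m2.monotoneOn o hx hx.1
    rw [F.f20] at a1
    exact ⟨a1, by have := F.im2 x hx; have := F.hh1; simp only [Matrix.cons_val]; linarith⟩

theorem Facts.lower (F : Facts f₀ f₁ f₂ γ lam δ h bH b B lp Q l L) (i : Fin 3) {x : ℝ}
    (hx : x ∈ Set.Icc (0:ℝ) 1) :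
    Real.log lam ≤ Real.log |deriv ((![f₀, f₁, f₂] : Fin 3 → ℝ → ℝ) i) x| := by
  rcases fin3_cases i with e | e | e
  · subst e
    exact Real.log_le_log F.hlam ((F.l0 x hx).trans (le_abs_self _))
  · subst e
    simp only [Matrix.cons_val_one, Matrix.cons_val_zero]
    rw [F.d1]
    exact Real.log_le_log F.hlam F.hlγ
  · subst e
    exact Real.log_le_log F.hlam ((F.l2 x hx).trans (le_abs_self _))

theorem Facts.dne (F : Facts f₀ f₁ f₂ γ lam δ h bH b B lp Q l L) (hf1 : ∀ x, deriv f₁ x = -γ)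
    (i : Fin 3) {x : ℝ}
    (hx : x ∈ Set.Icc (0:ℝ) 1) :
    deriv ((![f₀, f₁, f₂] : Fin 3 → ℝ → ℝ) i) x ≠ 0 := by
  rcases fin3_cases i with e | e | e
  · subst e
    exact (F.hlam.trans_le (F.l0 x hx)).ne'
  · subst e
    simp only [Matrix.cons_val_one, Matrix.cons_val_zero]
    rw [hf1]
    exact neg_ne_zero.2 F.hγ.ne'
  · subst e
    exact (F.hlam.trans_le (F.l2 x hx)).ne'

theorem seqComp_deriv (fs : Fin 3 → ℝ → ℝ) (hd : ∀ i, Differentiable ℝ (fs i)) (ξ : ℕ → Fin 3) (p : ℝ)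
    (n : ℕ) : DifferentiableAt ℝ (seqComp fs ξ n) p ∧
      deriv (seqComp fs ξ (n+1)) p = deriv (fs (ξ n)) (seqComp fs ξ n p) * deriv (seqComp fs ξ n) p := by
  have hD : ∀ n, DifferentiableAt ℝ (seqComp fs ξ n) p := by
    intro n
    induction n with
    | zero => exact differentiableAt_id
    | succ n ih => exact ((hd (ξ n)) _).comp p ih
  refine ⟨hD n, ?_⟩
  exact deriv_comp p ((hd (ξ n)) _) (hD n)

theorem Facts.orbit (F : Facts f₀ f₁ f₂ γ lam δ h bH b B lp Q l L) (ξ : ℕ → Fin 3) {p : ℝ}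
    (hp : p ∈ Set.Icc (0:ℝ) 1) (n : ℕ) : seqComp ![f₀, f₁, f₂] ξ n p ∈ Set.Icc (0:ℝ) 1 := by
  induction n with
  | zero => exact hp
  | succ n ih => exact F.maps (ξ n) ih

theorem Facts.Sstep (F : Facts f₀ f₁ f₂ γ lam δ h bH b B lp Q l L) (hf1 : ∀ x, deriv f₁ x = -γ)
    (hd : ∀ i, Differentiable ℝ ((![f₀, f₁, f₂] : Fin 3 → ℝ → ℝ) i)) (ξ : ℕ → Fin 3) {p : ℝ}
    (hp : p ∈ Set.Icc (0:ℝ) 1) (n : ℕ) :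
    deriv (seqComp ![f₀, f₁, f₂] ξ n) p ≠ 0 ∧
    Real.log |deriv (seqComp ![f₀, f₁, f₂] ξ (n+1)) p| = Real.log |deriv (seqComp ![f₀, f₁, f₂] ξ n) p|
      + Real.log |deriv ((![f₀, f₁, f₂] : Fin 3 → ℝ → ℝ) (ξ n)) (seqComp ![f₀, f₁, f₂] ξ n p)| := by
  have hne : ∀ n, deriv (seqComp ![f₀, f₁, f₂] ξ n) p ≠ 0 := by
    intro n
    induction n with
    | zero => simp [seqComp]
    | succ n ih =>
      rw [(seqComp_deriv _ hd ξ p n).2]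
      exact mul_ne_zero (F.dne hf1 _ (F.orbit ξ hp n)) ih
  refine ⟨hne n, ?_⟩
  rw [(seqComp_deriv _ hd ξ p n).2, abs_mul, Real.log_mul
    (abs_ne_zero.2 (F.dne hf1 _ (F.orbit ξ hp n))) (abs_ne_zero.2 (hne n)), add_comm]

theorem Facts.bound (F : Facts f₀ f₁ f₂ γ lam δ h bH b B lp Q l L) (hf1 : ∀ x, deriv f₁ x = -γ)
    (hd : ∀ i, Differentiable ℝ ((![f₀, f₁, f₂] : Fin 3 → ℝ → ℝ) i)) (ξ : ℕ → Fin 3) {p : ℝ}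
    (hp : p ∈ Set.Icc (0:ℝ) 1) (hE : ¬ exceptional ![f₀, f₁, f₂] p ξ) :
    ∃ C : ℝ, ∃ m : ℕ, ∀ n ≥ m, Real.log |deriv (seqComp ![f₀, f₁, f₂] ξ n) p| ≤ n * b + C := by
  have hb := F.hb
  by_cases hm : ∃ m, seqComp ![f₀, f₁, f₂] ξ m p ∈ Set.Ioo (0:ℝ) 1
  · obtain ⟨m, hm⟩ := hm
    obtain ⟨C, hC⟩ := F.core (fun n => seqComp ![f₀, f₁, f₂] ξ (m + n) p)
      (fun n => Real.log |deriv (seqComp ![f₀, f₁, f₂] ξ (m + n)) p|) (fun n => ξ (m + n))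
      (fun n => rfl) (fun n => (F.Sstep hf1 hd ξ hp (m + n)).2) hm
    refine ⟨C, m, fun n hn => ?_⟩
    obtain ⟨j, rfl⟩ := Nat.exists_eq_add_of_le hn
    have := hC j
    push_cast
    have : (0:ℝ) ≤ m * b := by positivity
    linarith
  · push Not at hm
    have h01 : ∀ n, seqComp ![f₀, f₁, f₂] ξ n p = 0 ∨ seqComp ![f₀, f₁, f₂] ξ n p = 1 := by
      intro n
      have h1 := F.orbit ξ hp n
      have h2 := hm n
      by_contra hcon
      push Not at hcon
      exact h2 ⟨lt_of_le_of_ne h1.1 (Ne.symm hcon.1), lt_of_le_of_ne h1.2 hcon.2⟩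
    have hone : ∀ n, seqComp ![f₀, f₁, f₂] ξ n p = 1 := by
      intro n
      refine (h01 n).resolve_left fun h0 => hE ⟨n, h0, ?_⟩
      have hz : ∀ j, seqComp ![f₀, f₁, f₂] ξ (n + j) p = 0 ∧ (ξ (n+j) = 0 ∨ ξ (n+j) = 2) := by
        have st : ∀ i, seqComp ![f₀, f₁, f₂] ξ i p = 0 → (ξ i = 0 ∨ ξ i = 2) := by
          intro i hi
          rcases fin3_cases (ξ i) with e | e | e
          · exact Or.inl e
          · exfalso
            apply hm (i+1)
            have : seqComp ![f₀, f₁, f₂] ξ (i+1) p = γ := by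
              simp only [seqComp, e, hi, Matrix.cons_val_one, Matrix.cons_val_zero]
              rw [F.hf1]; ring
            rw [this]
            exact ⟨F.hγ, F.hγ1⟩
          · exact Or.inr e
        intro j
        induction j with
        | zero => exact ⟨h0, st _ h0⟩
        | succ j ih =>
          have : seqComp ![f₀, f₁, f₂] ξ (n+j+1) p = 0 := by
            rcases ih.2 with e | e
            · simp only [seqComp, e, ih.1, Matrix.cons_val_zero, F.f00]
            · simp only [seqComp, e, ih.1, Matrix.cons_val, F.f20]
          exact ⟨this, st _ this⟩
      intro j hj
      obtain ⟨i, rfl⟩ := Nat.exists_eq_add_of_le hj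
      exact (hz i).2
    refine ⟨0, 0, fun n _ => ?_⟩
    have hδ1 : δ ≤ 1 := by linarith [F.hδh, F.hh1]
    induction n with
    | zero => simp [seqComp]
    | succ n ih =>
      rw [(F.Sstep hf1 hd ξ hp n).2, hone n]
      have : Real.log |deriv ((![f₀, f₁, f₂] : Fin 3 → ℝ → ℝ) (ξ n)) 1| ≤ b := by
        rcases fin3_cases (ξ n) with e | e | e
        · rw [e]; exact F.b0 1 ⟨hδ1, le_rfl⟩
        · rw [e]
          simp only [Matrix.cons_val_one, Matrix.cons_val_zero]
          rw [F.d1]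
          linarith [Real.log_neg F.hγ F.hγ1]
        · rw [e]; exact F.b2 1 ⟨hδ1, le_rfl⟩
      have h3 := ih (Nat.zero_le _)
      push_cast
      linarith

theorem Facts.ulower (F : Facts f₀ f₁ f₂ γ lam δ h bH b B lp Q l L) (hf1 : ∀ x, deriv f₁ x = -γ)
    (hd : ∀ i, Differentiable ℝ ((![f₀, f₁, f₂] : Fin 3 → ℝ → ℝ) i)) (ξ : ℕ → Fin 3) {p : ℝ}
    (hp : p ∈ Set.Icc (0:ℝ) 1) (n : ℕ) :
    Real.log lam ≤ (1 / (n:ℝ)) * Real.log |deriv (seqComp ![f₀, f₁, f₂] ξ n) p| := by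
  have h1 : n * Real.log lam ≤ Real.log |deriv (seqComp ![f₀, f₁, f₂] ξ n) p| := by
    induction n with
    | zero => simp [seqComp]
    | succ n ih =>
      rw [(F.Sstep hf1 hd ξ hp n).2]
      have := F.lower (ξ n) (F.orbit ξ hp n)
      push_cast
      linarith
  rcases Nat.eq_zero_or_pos n with rfl | hn
  · simpa using (Real.log_neg F.hlam F.hlam1).le
  · have : (0:ℝ) < n := by exact_mod_cast hn
    rw [one_div, inv_mul_eq_div, le_div_iff₀ this]
    linarith

theorem Facts.uupper (F : Facts f₀ f₁ f₂ γ lam δ h bH b B lp Q l L) (hf1 : ∀ x, deriv f₁ x = -γ)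
    (hd : ∀ i, Differentiable ℝ ((![f₀, f₁, f₂] : Fin 3 → ℝ → ℝ) i)) (ξ : ℕ → Fin 3) {p : ℝ}
    (hp : p ∈ Set.Icc (0:ℝ) 1) (hE : ¬ exceptional ![f₀, f₁, f₂] p ξ) (ε : ℝ) (hε : 0 < ε) :
    ∀ᶠ n : ℕ in atTop, (1 / (n:ℝ)) * Real.log |deriv (seqComp ![f₀, f₁, f₂] ξ n) p| ≤ b + ε := by
  obtain ⟨C, m, hC⟩ := F.bound hf1 hd ξ hp hE
  obtain ⟨K, hK⟩ := exists_nat_gt (C / ε)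
  filter_upwards [eventually_ge_atTop m, eventually_ge_atTop K, eventually_gt_atTop 0] with n h1 h2 h3
  have : (0:ℝ) < n := by exact_mod_cast h3
  rw [one_div, inv_mul_eq_div, div_le_iff₀ this]
  have h4 := hC n h1
  have h5 : (K:ℝ) ≤ n := by exact_mod_cast h2
  have h6 := (div_lt_iff₀ hε).1 (hK.trans_le h5)
  linarith

theorem Facts.main (F : Facts f₀ f₁ f₂ γ lam δ h bH b B lp Q l L) (hf1 : ∀ x, deriv f₁ x = -γ)
    (hd : ∀ i, Differentiable ℝ ((![f₀, f₁, f₂] : Fin 3 → ℝ → ℝ) i)) (ξ : ℕ → Fin 3) {p : ℝ}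
    (hp : p ∈ Set.Icc (0:ℝ) 1) (hE : ¬ exceptional ![f₀, f₁, f₂] p ξ) :
    lyapUpper ![f₀, f₁, f₂] p ξ ≤ b := by
  apply le_of_forall_pos_le_add
  intro ε hε
  refine Filter.limsup_le_of_le ?_ (F.uupper hf1 hd ξ hp hE ε hε)
  exact Filter.IsBoundedUnder.isCoboundedUnder_le
    ⟨Real.log lam, Filter.eventually_map.2 (Eventually.of_forall fun n => F.ulower hf1 hd ξ hp n)⟩

theorem iter_tendsto (hc : Continuous f₀) (hm : Set.MapsTo f₀ (Set.Icc 0 1) (Set.Icc 0 1))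
    (h00 : f₀ 0 = 0) (h01 : f₀ 1 = 1) (hinc : ∀ x ∈ Set.Ioo (0:ℝ) 1, x < f₀ x)
    {x : ℝ} (hx : x ∈ Set.Ioo (0:ℝ) 1) : Tendsto (fun n => f₀^[n] x) atTop (nhds 1) := by
  have hI : ∀ n, f₀^[n] x ∈ Set.Icc (0:ℝ) 1 := fun n => hm.iterate n ⟨hx.1.le, hx.2.le⟩
  have hle : ∀ y ∈ Set.Icc (0:ℝ) 1, y ≤ f₀ y := by
    intro y hy
    rcases hy.1.eq_or_lt with h | h
    · rw [← h, h00]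
    · rcases hy.2.eq_or_lt with h' | h'
      · rw [h', h01]
      · exact (hinc y ⟨h, h'⟩).le
  have hmono : Monotone (fun n => f₀^[n] x) := by
    apply monotone_nat_of_le_succ
    intro n
    rw [Function.iterate_succ_apply']
    exact hle _ (hI n)
  have hbdd : BddAbove (Set.range (fun n => f₀^[n] x)) := ⟨1, by rintro _ ⟨n, rfl⟩; exact (hI n).2⟩
  have ht := tendsto_atTop_ciSup hmono hbdd
  set y := ⨆ n, f₀^[n] x with hy
  have hfix : f₀ y = y := isFixedPt_of_tendsto_iterate ht hc.continuousAt
  have h1 : x ≤ y := le_ciSup hbdd 0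
  have h2 : y ≤ 1 := ciSup_le fun n => (hI n).2
  have : y = 1 := by
    by_contra hne
    have := hinc y ⟨hx.1.trans_le h1, lt_of_le_of_ne h2 hne⟩
    linarith
  rwa [this] at ht

/-- an expanding periodic point -/
theorem exists_periodic {β₀ : ℝ} (h0 : F0cond f₀ β₀ lam) (h01 : F01cond f₀ β₀ lam γ) (hlγ : lam ≤ γ)
    (hγ1 : γ < 1) :
    ∃ n : ℕ, ∃ q ∈ Set.Ioo (0:ℝ) 1, γ * (1 - f₀^[n] q) = q ∧
      1 < γ * ∏ i ∈ Finset.range n, deriv f₀ (f₀^[i] q) := by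
  obtain ⟨hC, hm, hs, h00, h01', hinc, hd0, hβ, hd1, hl, hl1, hlow⟩ := h0
  obtain ⟨hanti, hF⟩ := h01
  have hγ : 0 < γ := hl.trans_le hlγ
  have hβ0 : 0 < β₀ := by linarith
  have hdiff : Differentiable ℝ f₀ := hC.differentiable (by norm_num)
  have hcd : Continuous (deriv f₀) := hC.continuous_deriv (by norm_num)
  -- the numerical consequence
  have hnum : lam < 2 - β₀ := by
    have e1 : 0 < 1 - β₀⁻¹ := by
      have := inv_lt_one_of_one_lt₀ hβ
      linarith
    have e2 : 1 - β₀⁻¹ < γ * (lam ^ 3 * (1 - lam)) := by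
      rw [← mul_div_assoc, lt_div_iff₀ e1] at hF
      linarith
    have e3 : γ * (lam ^ 3 * (1 - lam)) ≤ lam ^ 3 * (1 - lam) := by
      have : 0 ≤ lam ^ 3 * (1 - lam) := mul_nonneg (by positivity) (by linarith)
      nlinarith
    have e4 : β₀ - 1 < lam ^ 3 * (1 - lam) * β₀ := by
      have := mul_lt_mul_of_pos_right (e2.trans_le e3) hβ0
      rw [sub_mul, inv_mul_cancel₀ hβ0.ne'] at this
      linarith
    by_contra hcon
    push Not at hcon
    -- β₀ ≥ 2 - lam, and β₀ (1 - lam^3(1-lam)) < 1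
    have e5 : 0 < 1 - lam ^ 3 * (1 - lam) := by
      have : lam ^ 3 < 1 := pow_lt_one₀ hl.le hl1 (by norm_num)
      nlinarith [pow_pos hl 3]
    have e6 : (2 - lam) * (1 - lam ^ 3 * (1 - lam)) < 1 := by
      have : (2 - lam) * (1 - lam ^ 3 * (1 - lam)) ≤ β₀ * (1 - lam ^ 3 * (1 - lam)) :=
        mul_le_mul_of_nonneg_right (by linarith) e5.le
      linarith
    have e7 : (2 - lam) * (1 - lam ^ 3 * (1 - lam)) - 1 = (1 - lam) * (1 - 2 * lam ^ 3 + lam ^ 4) := by ring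
    have e8 : 0 < 1 - 2 * lam ^ 3 + lam ^ 4 := by
      have : 1 - 2 * lam ^ 3 + lam ^ 4 = (1 - lam) * (1 + lam + lam^2 * (1 - lam)) := by ring
      rw [this]
      have : 0 < 1 - lam := by linarith
      positivity
    have : 0 < (1 - lam) * (1 - 2 * lam ^ 3 + lam ^ 4) := mul_pos (by linarith) e8
    linarith
  -- mean value bounds
  have mvt : ∀ x ∈ Set.Icc (0:ℝ) 1, ∀ y ∈ Set.Icc (0:ℝ) 1, x ≤ y →
      f₀ y - f₀ x ≤ deriv f₀ x * (y - x) := by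
    intro x hx y hy hxy
    refine Convex.image_sub_le_mul_sub_of_deriv_le (convex_Icc x y) hdiff.continuous.continuousOn
      hdiff.differentiableOn ?_ x ⟨le_rfl, hxy⟩ y ⟨hxy, le_rfl⟩ hxy
    intro z hz
    rw [interior_Icc] at hz
    exact hanti hx ⟨hx.1.trans hz.1.le, hz.2.le.trans hy.2⟩ hz.1.le
  obtain ⟨η, hη, hηd⟩ : ∃ η > 0, ∀ y, 1 - η < y → y ≤ 1 → deriv f₀ y < 2 - β₀ := by
    have : ∀ᶠ y in nhds (1:ℝ), deriv f₀ y < 2 - β₀ :=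
      hcd.continuousAt.eventually_lt continuousAt_const (by rw [hd1]; exact hnum)
    obtain ⟨η, hη, hh⟩ := Metric.eventually_nhds_iff.1 this
    refine ⟨η, hη, fun y h1 h2 => hh ?_⟩
    rw [Real.dist_eq, abs_lt]
    constructor <;> linarith
  set x0 : ℝ := min (γ * η) 1 / 2 with hx0
  have hpos : 0 < min (γ * η) 1 := lt_min (mul_pos hγ hη) one_pos
  have hx0I : x0 ∈ Set.Ioo (0:ℝ) 1 := ⟨by positivity, by have := min_le_right (γ * η) 1; linarith⟩
  have hx0η : x0 < γ * η := by have := min_le_left (γ * η) 1; linarith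
  have ht := iter_tendsto hdiff.continuous hm h00 h01' hinc hx0I
  have ht2 : Tendsto (fun n => γ * (1 - f₀^[n] x0)) atTop (nhds 0) := by
    have := (ht.const_sub 1).const_mul γ
    simpa using this
  obtain ⟨n, hn⟩ := (ht2.eventually (gt_mem_nhds hx0I.1)).exists
  -- intermediate value theorem
  have hcont : Continuous (fun x => x - γ * (1 - f₀^[n] x)) := by
    have := hdiff.continuous.iterate n
    fun_prop
  have hzero : f₀^[n] 0 = 0 := Function.iterate_fixed h00 n
  obtain ⟨q, hq, hq0⟩ := intermediate_value_Ioo (f := fun x => x - γ * (1 - f₀^[n] x)) hx0I.1.le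
    hcont.continuousOn (show (0:ℝ) ∈ Set.Ioo _ _ from ⟨by simp only [hzero]; linarith, by linarith⟩)
  have hqfix : γ * (1 - f₀^[n] q) = q := by simp only at hq0; linarith
  have hqI : q ∈ Set.Ioo (0:ℝ) 1 := ⟨hq.1, hq.2.trans hx0I.2⟩
  refine ⟨n, q, hqI, hqfix, ?_⟩
  have hI : ∀ i, f₀^[i] q ∈ Set.Icc (0:ℝ) 1 := fun n => hm.iterate n ⟨hqI.1.le, hqI.2.le⟩
  have hle : ∀ y ∈ Set.Icc (0:ℝ) 1, y ≤ f₀ y := by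
    intro y hy
    rcases hy.1.eq_or_lt with h | h
    · rw [← h, h00]
    · rcases hy.2.eq_or_lt with h' | h'
      · rw [h', h01']
      · exact (hinc y ⟨h, h'⟩).le
  have hprod : ∀ m : ℕ, f₀ (f₀^[m] q) - f₀^[m] q ≤
      (∏ i ∈ Finset.range m, deriv f₀ (f₀^[i] q)) * (f₀ q - q) := by
    intro m
    induction m with
    | zero => simp
    | succ m ih =>
      rw [Finset.prod_range_succ, Function.iterate_succ_apply']
      have g1 := mvt _ (hI m) _ (hm (hI m)) (hle _ (hI m))
      have g2 := mul_le_mul_of_nonneg_left ih (hl.le.trans (hlow _ (hI m)))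
      linarith
  set P := ∏ i ∈ Finset.range n, deriv f₀ (f₀^[i] q) with hP
  set y := f₀^[n] q with hy
  have hPpos : 0 < P := Finset.prod_pos fun i _ => hl.trans_le (hlow _ (hI i))
  have hy1 : 1 - y < η := by
    have : γ * (1 - y) < γ * η := by linarith [hq.2]
    exact lt_of_mul_lt_mul_left this hγ.le
  have hypos : 0 < 1 - y := by
    have : 0 < γ * (1 - y) := by rw [hqfix]; exact hqI.1
    exact pos_of_mul_pos_right this hγ.le
  have g1 : (β₀ - 1) * (1 - y) < f₀ y - y := by
    have a1 := mvt y (hI n) 1 ⟨zero_le_one, le_rfl⟩ (hI n).2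
    have a2 := mul_lt_mul_of_pos_right (hηd y (by linarith) (hI n).2) hypos
    rw [h01'] at a1
    linarith
  have g2 : f₀ q - q ≤ (β₀ - 1) * q := by
    have := mvt 0 ⟨le_rfl, zero_le_one⟩ q ⟨hqI.1.le, hqI.2.le⟩ hqI.1.le
    rw [h00, hd0] at this
    linarith
  have g3 := hprod n
  have g4 : P * (f₀ q - q) ≤ P * ((β₀ - 1) * q) := mul_le_mul_of_nonneg_left g2 hPpos.le
  have g5 : (β₀ - 1) * (1 - y) < P * ((β₀ - 1) * q) := by linarith
  have g6 : 1 * ((β₀ - 1) * (1 - y)) < (γ * P) * ((β₀ - 1) * (1 - y)) := by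
    calc 1 * ((β₀ - 1) * (1 - y)) < P * ((β₀ - 1) * q) := by linarith
      _ = P * ((β₀ - 1) * (γ * (1 - y))) := by rw [hqfix]
      _ = _ := by ring
  exact lt_of_mul_lt_mul_right g6 (mul_nonneg (by linarith) hypos.le)

theorem Facts.positive (F : Facts f₀ f₁ f₂ γ lam δ h bH b B lp Q l L) (hf1 : ∀ x, deriv f₁ x = -γ)
    (hd : ∀ i, Differentiable ℝ ((![f₀, f₁, f₂] : Fin 3 → ℝ → ℝ) i)) {n : ℕ} {q : ℝ}
    (hq : q ∈ Set.Ioo (0:ℝ) 1) (hfix : γ * (1 - f₀^[n] q) = q)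
    (hexp : 1 < γ * ∏ i ∈ Finset.range n, deriv f₀ (f₀^[i] q)) :
    ∃ ξ : ℕ → Fin 3, ¬ exceptional ![f₀, f₁, f₂] q ξ ∧ 0 < lyapUpper ![f₀, f₁, f₂] q ξ := by
  set ξ : ℕ → Fin 3 := fun j => if j % (n+1) = n then 1 else 0 with hξ
  have hqI : q ∈ Set.Icc (0:ℝ) 1 := ⟨hq.1.le, hq.2.le⟩
  have hE : ¬ exceptional ![f₀, f₁, f₂] q ξ := by
    rintro ⟨m, _, hm⟩
    have := hm (m * (n+1) + n) (by nlinarith)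
    have e : (m * (n+1) + n) % (n+1) = n := by
      rw [Nat.mul_add_mod', Nat.mod_eq_of_lt (by omega)]
    simp [hξ, e] at this
  refine ⟨ξ, hE, ?_⟩
  set x : ℕ → ℝ := fun j => seqComp ![f₀, f₁, f₂] ξ j q with hx
  set S : ℕ → ℝ := fun j => Real.log |deriv (seqComp ![f₀, f₁, f₂] ξ j) q| with hS
  have hS0 : S 0 = 0 := by simp [hS, seqComp]
  have hSs : ∀ j, S (j+1) = S j + Real.log |deriv ((![f₀, f₁, f₂] : Fin 3 → ℝ → ℝ) (ξ j)) (x j)| :=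
    fun j => (F.Sstep hf1 hd ξ hqI j).2
  have hxs : ∀ j, x (j+1) = (![f₀, f₁, f₂] : Fin 3 → ℝ → ℝ) (ξ j) (x j) := fun j => rfl
  have hξ0 : ∀ k j, j < n → ξ (k * (n+1) + j) = 0 := by
    intro k j hj
    have : (k * (n+1) + j) % (n+1) = j := by
      rw [Nat.mul_add_mod', Nat.mod_eq_of_lt (by omega)]
    simp [hξ, this, hj.ne]
  have hξ1 : ∀ k, ξ (k * (n+1) + n) = 1 := by
    intro k
    have : (k * (n+1) + n) % (n+1) = n := by
      rw [Nat.mul_add_mod', Nat.mod_eq_of_lt (by omega)]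
    simp [hξ, this]
  set P := ∏ i ∈ Finset.range n, deriv f₀ (f₀^[i] q) with hP
  have hstep : ∀ k j, j ≤ n → x (k * (n+1)) = q → x (k * (n+1) + j) = f₀^[j] q ∧
      S (k * (n+1) + j) = S (k * (n+1)) + ∑ i ∈ Finset.range j, Real.log |deriv f₀ (f₀^[i] q)| := by
    intro k j hj hk
    induction j with
    | zero => simpa using hk
    | succ j ih =>
      obtain ⟨i1, i2⟩ := ih (by omega)
      rw [← add_assoc, hxs, hSs, i1, i2, hξ0 k j (by omega), Finset.sum_range_succ,
        Function.iterate_succ_apply']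
      simp only [Matrix.cons_val_zero]
      exact ⟨trivial, by ring⟩
  have hIt : ∀ i, f₀^[i] q ∈ Set.Icc (0:ℝ) 1 := by
    intro i
    induction i with
    | zero => exact hqI
    | succ i ih => rw [Function.iterate_succ_apply']; exact F.maps 0 ih
  have hne : ∀ i, deriv f₀ (f₀^[i] q) ≠ 0 := fun i => (F.hlam.trans_le (F.l0 _ (hIt i))).ne'
  have hPpos : 0 < P := Finset.prod_pos fun i _ => F.hlam.trans_le (F.l0 _ (hIt i))
  have hsum : ∑ i ∈ Finset.range n, Real.log |deriv f₀ (f₀^[i] q)| = Real.log P := by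
    rw [hP, Real.log_prod (fun i _ => hne i)]
    exact Finset.sum_congr rfl fun i _ => Real.log_abs _
  have hper : ∀ k : ℕ, x (k * (n+1)) = q ∧ S (k * (n+1)) = k * Real.log (γ * P) := by
    intro k
    induction k with
    | zero => simp [hx, seqComp, hS0]
    | succ k ih =>
      obtain ⟨i1, i2⟩ := hstep k n le_rfl ih.1
      have e : (k+1) * (n+1) = k * (n+1) + n + 1 := by ring
      rw [e, hxs, hSs, i1, i2, hξ1, hsum, ih.2]
      simp only [Matrix.cons_val_one, Matrix.cons_val_zero]
      rw [F.d1, F.hf1, Real.log_mul F.hγ.ne' hPpos.ne']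
      refine ⟨hfix, by push_cast; ring⟩
  have hc : 0 < Real.log (γ * P) / ((n:ℝ) + 1) := div_pos (Real.log_pos hexp) (by positivity)
  refine hc.trans_le ?_
  apply Filter.le_limsup_of_frequently_le
  · rw [Filter.frequently_atTop]
    intro a
    refine ⟨(a+1) * (n+1), by nlinarith, ?_⟩
    have := (hper (a+1)).2
    simp only [hS] at this
    rw [this]
    push_cast
    have h1 : (0:ℝ) < (a:ℝ) + 1 := by positivity
    have h2 : (0:ℝ) < (n:ℝ) + 1 := by positivity
    apply le_of_eq
    field_simp
  · exact ⟨b + 1, Filter.eventually_map.2 (F.uupper hf1 hd ξ hqI hE 1 one_pos)⟩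

end

theorem mkFacts (f₀ f₁ f₂ : ℝ → ℝ) (β₀ lam₀ γ β₂ δ βpr βH lampr : ℝ) (L : ℕ)
    (h0 : F0cond f₀ β₀ lam₀) (h1 : F1cond f₁ γ lam₀) (h2 : F2cond f₂ β₂ lam₀)
    (h012 : F012cond f₀ f₁ f₂ γ lam₀ β₀ β₂ δ βpr βH lampr L) :
    Facts f₀ f₁ f₂ γ lam₀ δ (1 - γ⁻¹ * δ) βH (Real.log βpr) (Real.log (max β₀ β₂)) (Real.log lampr)
      (|Real.log lam₀| * Real.log (max β₀ β₂) / Real.log βH) (|Real.log lam₀|) L := by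
  obtain ⟨hC, hm, hs, h00, h01', hinc, hd0, hβ, hd1, hl, hl1, hlow⟩ := h0
  obtain ⟨hf1, hlγ, hγ1⟩ := h1
  obtain ⟨hC2, hm2, hs2, h20, hd20, hβ2, hlow2, -⟩ := h2
  obtain ⟨hmax, hδ, hδγ, i1, i2, i3, i4, gpr, hpr1, hprβ, gH, hH1, hHβ, glam, hlam1, hQ1, hL1, hQL, hLB⟩ := h012
  have hγ : 0 < γ := hl.trans_le hlγ
  have hdiff : Differentiable ℝ f₀ := hC.differentiable (by norm_num)
  have hdiff2 : Differentiable ℝ f₂ := hC2.differentiable (by norm_num)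
  have hδ1 : δ < 1 := by linarith
  have hgδ : 0 < γ⁻¹ * δ := by positivity
  have hcancel : γ * (γ⁻¹ * δ) = δ := by field_simp
  have hh : ∀ x, 1 - γ⁻¹ * δ ≤ x ↔ γ * (1 - x) ≤ δ := by
    intro x
    constructor
    · intro hx
      have := mul_le_mul_of_nonneg_left (show 1 - x ≤ γ⁻¹ * δ by linarith) hγ.le
      linarith
    · intro hx
      have : γ * (1 - x) ≤ γ * (γ⁻¹ * δ) := by linarith
      have := le_of_mul_le_mul_left this hγ
      linarith
  have hδh : δ < 1 - γ⁻¹ * δ := by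
    by_contra hcon
    have : δ ∈ (f₁ '' Set.Icc (1 - γ⁻¹ * δ) 1) ∩ Set.Icc (1 - γ⁻¹ * δ) 1 := by
      refine ⟨⟨1 - γ⁻¹ * δ, ⟨le_rfl, by linarith⟩, ?_⟩, not_lt.1 hcon, hδ1.le⟩
      rw [hf1]; linarith
    rw [i2] at this
    exact this
  have hγh : γ < 1 - γ⁻¹ * δ := by
    by_contra hcon
    have : γ ∈ (f₁ '' Set.Icc 0 1) ∩ Set.Icc (1 - γ⁻¹ * δ) 1 := by
      refine ⟨⟨0, ⟨le_rfl, zero_le_one⟩, ?_⟩, not_lt.1 hcon, hγ1.le⟩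
      rw [hf1]; ring
    rw [i3] at this
    exact this
  have im2 : ∀ x ∈ Set.Icc (0:ℝ) 1, f₂ x < 1 - γ⁻¹ * δ := by
    intro x hx
    by_contra hcon
    have : f₂ x ∈ (f₂ '' Set.Icc 0 1) ∩ Set.Icc (1 - γ⁻¹ * δ) 1 :=
      ⟨⟨x, hx, rfl⟩, not_lt.1 hcon, (hm2 hx).2⟩
    rw [i4] at this
    exact this
  have p0 : ∀ x ∈ Set.Icc (0:ℝ) 1, 0 < deriv f₀ x := fun x hx => hl.trans_le (hlow x hx)
  have p2 : ∀ x ∈ Set.Icc (0:ℝ) 1, 0 < deriv f₂ x := fun x hx => hl.trans_le (hlow2 x hx)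
  have sub : ∀ x ∈ Set.Icc δ 1, x ∈ Set.Icc (0:ℝ) 1 := fun x hx => ⟨hδ.le.trans hx.1, hx.2⟩
  have lg : ∀ a c : ℝ, 0 < a → a ≤ c → Real.log |a| ≤ Real.log c := by
    intro a c ha hac
    rw [abs_of_pos ha]
    exact Real.log_le_log ha hac
  have hd1' : ∀ x, deriv f₁ x = -γ := by
    intro x
    have : f₁ = fun x => γ * (1 - x) := funext hf1
    rw [this]
    simp
  have hlp : lam₀ ≤ lampr := hd1 ▸ glam.2 ⟨1, ⟨by linarith, le_rfl⟩, rfl⟩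
  have hlogH : 0 < Real.log βH := Real.log_pos hH1
  have hlogpr : 0 < Real.log βpr := Real.log_pos hpr1
  have hprmax : βpr < max β₀ β₂ := hprβ.trans_le (min_le_max)
  have hHmax : βH < max β₀ β₂ := hHβ.trans_le (min_le_max)
  have hlogmax : Real.log βpr < Real.log (max β₀ β₂) := Real.log_lt_log (by linarith) hprmax
  have hlogHm : Real.log βH < Real.log (max β₀ β₂) := Real.log_lt_log (by linarith) hHmax
  have hlpneg : Real.log lampr < 0 := Real.log_neg (hl.trans_le hlp) hlam1
  have hmvt : ∀ f : ℝ → ℝ, Differentiable ℝ f → f 0 = 0 → (∀ x ∈ Set.Icc (0:ℝ) δ, βH ≤ deriv f x) →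
      ∀ x ∈ Set.Icc (0:ℝ) δ, βH * x ≤ f x := by
    intro f hf hf0 hfd x hx
    have := Convex.mul_sub_le_image_sub_of_le_deriv (convex_Icc 0 δ) hf.continuous.continuousOn
      hf.differentiableOn (C := βH) (fun z hz => hfd z (interior_subset hz)) 0 ⟨le_rfl, hδ.le⟩ x hx hx.1
    rw [hf0] at this
    linarith
  exact
  { hγ := hγ
    hγ1 := hγ1
    hlam := hl
    hlam1 := hl1
    hlγ := hlγ
    hδ := hδ
    hδh := hδh
    hh1 := by linarith
    hh := hh
    hf1 := hf1
    hγh := hγh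
    f00 := h00
    f01 := h01'
    f20 := h20
    m0 := hs
    m2 := hs2
    inc0 := hinc
    im2 := im2
    l0 := hlow
    l2 := hlow2
    B0 := fun x hx => lg _ _ (p0 x hx) (hmax x hx).1
    B2 := fun x hx => lg _ _ (p2 x hx) (hmax x hx).2
    b0 := fun x hx => lg _ _ (p0 x (sub x hx)) ((le_max_left _ _).trans (gpr.2 ⟨x, hx, rfl⟩))
    b2 := fun x hx => lg _ _ (p2 x (sub x hx)) ((le_max_right _ _).trans (gpr.2 ⟨x, hx, rfl⟩))
    lp0 := fun x hx => lg _ _ (p0 x ⟨by linarith [hx.1], hx.2⟩) (glam.2 ⟨x, hx, rfl⟩)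
    d1 := fun x => by rw [hd1', abs_neg, abs_of_pos hγ]
    c1 := fun x hx => by
      have := Convex.mul_sub_le_image_sub_of_le_deriv (convex_Icc (0:ℝ) 1) hdiff.continuous.continuousOn
        hdiff.differentiableOn (C := lam₀) (fun z hz => hlow z (interior_subset hz)) x hx 1
        ⟨zero_le_one, le_rfl⟩ hx.2
      rwa [h01'] at this
    e0 := hmvt f₀ hdiff h00 fun x hx => (gH.2 ⟨x, hx, rfl⟩).trans (min_le_left _ _)
    e2 := hmvt f₂ hdiff2 h20 fun x hx => (gH.2 ⟨x, hx, rfl⟩).trans (min_le_right _ _)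
    hbH := hH1
    hb := hlogpr
    hbB := hlogmax
    hlp := hlpneg
    hl := abs_of_neg (Real.log_neg hl hl1)
    hQ := by field_simp
    hlQ := by
      rw [le_div_iff₀ hlogH]
      exact mul_le_mul_of_nonneg_left hlogHm.le (abs_nonneg _)
    hQ1 := by
      rw [abs_of_neg hlpneg] at hQ1
      linarith
    hL1 := hL1
    hQL := by
      rw [div_lt_iff₀ (mul_pos hlogH hlogpr)] at hQL
      have : 4 * (|Real.log lam₀| * Real.log (max β₀ β₂) / Real.log βH) =
        4 * |Real.log lam₀| * Real.log (max β₀ β₂) / Real.log βH := by ring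
      rw [this, div_lt_iff₀ hlogH]
      linarith
    hLB := by
      have hmpos : 0 < max β₀ β₂ := by linarith
      rw [div_lt_iff₀ (by positivity), Real.log_mul (pow_pos hmpos _).ne' hγ.ne', Real.log_pow] at hLB
      linarith }

/-- spectral gap: every non-exceptional pair has upper exponent at most
`log β'`, and `χ̃ = sup { χ̄(p,ξ) : (p,ξ) ∉ E }` satisfies `0 < χ̃ < log β⁻`. -/
theorem stmt4 (f₀ f₁ f₂ : ℝ → ℝ) (β₀ lam₀ γ β₂ δ βpr βH lampr : ℝ) (L : ℕ)
    (h0 : F0cond f₀ β₀ lam₀) (h1 : F1cond f₁ γ lam₀) (h2 : F2cond f₂ β₂ lam₀)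
    (h01 : F01cond f₀ β₀ lam₀ γ)
    (h012 : F012cond f₀ f₁ f₂ γ lam₀ β₀ β₂ δ βpr βH lampr L) :
    (∀ p ∈ Set.Icc (0:ℝ) 1, ∀ ξ : ℕ → Fin 3, ¬ exceptional ![f₀, f₁, f₂] p ξ →
      lyapUpper ![f₀, f₁, f₂] p ξ ≤ Real.log βpr) ∧
    0 < sSup {c : ℝ | ∃ p ∈ Set.Icc (0:ℝ) 1, ∃ ξ : ℕ → Fin 3,
        ¬ exceptional ![f₀, f₁, f₂] p ξ ∧ lyapUpper ![f₀, f₁, f₂] p ξ = c} ∧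
    sSup {c : ℝ | ∃ p ∈ Set.Icc (0:ℝ) 1, ∃ ξ : ℕ → Fin 3,
        ¬ exceptional ![f₀, f₁, f₂] p ξ ∧ lyapUpper ![f₀, f₁, f₂] p ξ = c}
      < Real.log (min β₀ β₂) := by
  have F := mkFacts f₀ f₁ f₂ β₀ lam₀ γ β₂ δ βpr βH lampr L h0 h1 h2 h012
  have hf1 : ∀ x, deriv f₁ x = -γ := by
    intro x
    have : f₁ = fun x => γ * (1 - x) := funext h1.1
    rw [this]
    simp
  have hd : ∀ i, Differentiable ℝ ((![f₀, f₁, f₂] : Fin 3 → ℝ → ℝ) i) := by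
    intro i
    rcases fin3_cases i with e | e | e
    · subst e; exact h0.1.differentiable (by norm_num)
    · subst e
      have : f₁ = fun x => γ * (1 - x) := funext h1.1
      simp only [Matrix.cons_val_one, Matrix.cons_val_zero]
      rw [this]
      fun_prop
    · subst e; exact h2.1.differentiable (by norm_num)
  have hmain : ∀ p ∈ Set.Icc (0:ℝ) 1, ∀ ξ : ℕ → Fin 3, ¬ exceptional ![f₀, f₁, f₂] p ξ →
      lyapUpper ![f₀, f₁, f₂] p ξ ≤ Real.log βpr := fun p hp ξ hE => F.main hf1 hd ξ hp hE
  obtain ⟨n, q, hq, hfix, hexp⟩ := exists_periodic h0 h01 h1.2.1 h1.2.2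
  obtain ⟨ξ, hE, hpos⟩ := F.positive hf1 hd hq hfix hexp
  have hprlt : Real.log βpr < Real.log (min β₀ β₂) := by
    obtain ⟨-, -, -, -, -, -, -, -, h1, h2, -⟩ := h012
    exact Real.log_lt_log (by linarith) h2
  refine ⟨hmain, ?_, ?_⟩
  · refine hpos.trans_le (le_csSup ⟨Real.log βpr, ?_⟩ ⟨q, ⟨hq.1.le, hq.2.le⟩, ξ, hE, rfl⟩)
    rintro _ ⟨p, hp, ξ, hE, rfl⟩
    exact hmain p hp ξ hE
  · refine lt_of_le_of_lt (csSup_le ⟨_, q, ⟨hq.1.le, hq.2.le⟩, ξ, hE, rfl⟩ ?_) hprlt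
    rintro _ ⟨p, hp, ξ, hE, rfl⟩
    exact hmain p hp ξ hE

end
end

section
/- (Measure of maximal entropy with nonpositive central exponent.) Assume (F0), (F1) and (F2). There exists an ergodic G-invariant Borel probability measure μ with μ(Λ_G)=1 such that π⁎μ is the (1/3,1/3,1/3)-Bernoulli measure on Σ₃ and χ(μ) ≤ 0. -/
open Set Filter MeasureTheory

noncomputable section

section aux
set_option linter.unusedSectionVars false
open scoped Topology ENNReal BoundedContinuousFunction
variable {X Y : Type*} [TopologicalSpace X] [T2Space X] [CompactSpace X] [MeasurableSpace X]
  [BorelSpace X] [HasOuterApproxClosed X]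
  [TopologicalSpace Y] [T2Space Y] [MeasurableSpace Y] [BorelSpace Y] [HasOuterApproxClosed Y]

/-- Cesaro average. -/
def cesaro (G : X → X) (m : Measure X) (n : ℕ) : Measure X :=
  ((n + 1 : ℕ) : ℝ≥0∞)⁻¹ • ∑ k ∈ Finset.range (n+1), m.map (G^[k])

lemma cesaro_prob {G : X → X} (hG : Continuous G) (m : Measure X) [IsProbabilityMeasure m] (n : ℕ) :
    IsProbabilityMeasure (cesaro G m n) := by
  constructor
  have : ∀ k, m.map (G^[k]) univ = 1 := fun k => by
    rw [Measure.map_apply (hG.iterate k).measurable MeasurableSet.univ]; simp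
  simp only [cesaro, Measure.smul_apply, Measure.coe_finsetSum, Finset.sum_apply, this]
  simp
  refine ENNReal.inv_mul_cancel (by simp) (by finiteness)

lemma cesaro_integral {G : X → X} (hG : Continuous G) (m : Measure X) [IsProbabilityMeasure m]
    (n : ℕ) {g : X → ℝ} (hg : Continuous g) :
    ∫ x, g x ∂(cesaro G m n) =
      ((n + 1 : ℕ) : ℝ)⁻¹ * ∑ k ∈ Finset.range (n+1), ∫ x, g (G^[k] x) ∂m := by
  rw [cesaro, integral_smul_measure, integral_finsetSum_measure]
  · rw [smul_eq_mul]
    congr 1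
    · rw [ENNReal.toReal_inv, ENNReal.toReal_natCast]
    · refine Finset.sum_congr rfl fun k _ => ?_
      rw [integral_map (hG.iterate k).measurable.aemeasurable hg.aestronglyMeasurable]
  · intro k _
    have := Measure.isProbabilityMeasure_map (μ := m) (hG.iterate k).measurable.aemeasurable
    exact hg.integrable_of_hasCompactSupport (HasCompactSupport.of_compactSpace _)

lemma exists_invariant {G : X → X} (hG : Continuous G) {p : X → Y} (hp : Continuous p)
    {σ : Y → Y} (hpG : ∀ x, p (G x) = σ (p x)) {ν : Measure Y} 
    (hσ : MeasurePreserving σ ν ν) (m : Measure X) [IsProbabilityMeasure m] (hm : m.map p = ν)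
    {φ : X → ℝ} (hφ : Continuous φ)
    (hneg : ∀ n, ∑ k ∈ Finset.range n, ∫ x, φ (G^[k] x) ∂m ≤ 0) :
    ∃ μ : ProbabilityMeasure X, (μ : Measure X).map G = μ ∧ (μ : Measure X).map p = ν ∧
      ∫ x, φ x ∂(μ : Measure X) ≤ 0 := by
  let P : ℕ → ProbabilityMeasure X := fun n => ⟨cesaro G m n, cesaro_prob hG m n⟩
  let U := (hyperfilter ℕ).map P
  have hU : Tendsto P (hyperfilter ℕ : Filter ℕ) (𝓝 U.lim) := U.le_nhds_lim
  set μ := U.lim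
  have hν : IsProbabilityMeasure ν := by
    rw [← hm]; exact Measure.isProbabilityMeasure_map hp.measurable.aemeasurable
  have hint := ProbabilityMeasure.tendsto_iff_forall_integral_tendsto.1 hU
  have hint' : ∀ g : X → ℝ, Continuous g → Tendsto (fun n : ℕ => 
      ((n + 1 : ℕ) : ℝ)⁻¹ * ∑ k ∈ Finset.range (n+1), ∫ x, g (G^[k] x) ∂m)
      (hyperfilter ℕ : Filter ℕ) (𝓝 (∫ x, g x ∂(μ : Measure X))) := by
    intro g hg
    have := hint (BoundedContinuousFunction.mkOfCompact ⟨g, hg⟩)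
    refine this.congr fun n => ?_
    exact cesaro_integral hG m n hg
  have hi : ∀ (g : X → ℝ), Continuous g → ∀ n : ℕ, Integrable (fun x => g (G^[n] x)) m :=
    fun g hg n => (hg.comp (hG.iterate n)).integrable_of_hasCompactSupport
      (HasCompactSupport.of_compactSpace _)
  refine ⟨μ, ?_, ?_, ?_⟩
  · have := Measure.isProbabilityMeasure_map (μ := (μ : Measure X)) hG.measurable.aemeasurable
    apply ext_of_forall_integral_eq_of_IsFiniteMeasure
    intro f
    rw [integral_map hG.measurable.aemeasurable f.continuous.aestronglyMeasurable]
    have h1 := hint' (fun x => f (G x)) (f.continuous.comp hG)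
    have h2 := hint' f f.continuous
    have h3 := h1.sub h2
    have h4 : Tendsto (fun n : ℕ => ((n + 1 : ℕ) : ℝ)⁻¹ * (2 * ‖f‖)) atTop (𝓝 0) := by
      have := (tendsto_inv_atTop_nhds_zero_nat (𝕜 := ℝ)).comp (tendsto_add_atTop_nat 1)
      simpa using this.mul_const (2 * ‖f‖)
    have h5 : Tendsto (fun n : ℕ => ((n + 1 : ℕ) : ℝ)⁻¹ * ∑ k ∈ Finset.range (n+1), ∫ x, f (G (G^[k] x)) ∂m
        - ((n + 1 : ℕ) : ℝ)⁻¹ * ∑ k ∈ Finset.range (n+1), ∫ x, f (G^[k] x) ∂m)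
        (hyperfilter ℕ : Filter ℕ) (𝓝 0) := by
      refine squeeze_zero_norm (fun n => ?_) (h4.mono_left Nat.hyperfilter_le_atTop)
      rw [← mul_sub, norm_mul, ← Finset.sum_sub_distrib]
      have : ∀ k, ∫ x, f (G (G^[k] x)) ∂m = ∫ x, f (G^[k+1] x) ∂m := fun k => by
        simp only [Function.iterate_succ_apply']
      simp only [this]
      rw [Finset.sum_range_sub (fun k => ∫ x, f (G^[k] x) ∂m)]
      have hb : ∀ k : ℕ, ‖∫ x, f (G^[k] x) ∂m‖ ≤ ‖f‖ := fun k => by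
        refine (norm_integral_le_of_norm_le_const (C := ‖f‖) 
          (Eventually.of_forall fun x => f.norm_coe_le_norm _)).trans ?_
        simp
      have := norm_sub_le (∫ x, f (G^[n+1] x) ∂m) (∫ x, f (G^[0] x) ∂m)
      have h6 := hb (n+1)
      have h7 := hb 0
      rw [norm_inv, Real.norm_natCast]
      gcongr
      linarith
    exact sub_eq_zero.1 (tendsto_nhds_unique h3 h5)
  · have hc := ((ProbabilityMeasure.continuous_map hp).tendsto μ).comp hU
    let N : ProbabilityMeasure Y := ⟨ν, hν⟩
    have he : ∀ n, (P n).map hp.measurable.aemeasurable = N := by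
      intro n
      apply Subtype.ext
      show (cesaro G m n).map p = ν
      have hk : ∀ k, (m.map (G^[k])).map p = ν := by
        intro k
        rw [Measure.map_map hp.measurable (hG.iterate k).measurable]
        have : p ∘ G^[k] = σ^[k] ∘ p := by
          funext x
          exact (Function.Semiconj.iterate_right (f := p) (ga := G) (gb := σ) hpG k) x
        rw [this, ← Measure.map_map (hσ.iterate k).measurable hp.measurable, hm,
          (hσ.iterate k).map_eq]
      rw [cesaro, Measure.map_smul, ← Measure.mapₗ_apply_of_measurable hp.measurable, map_sum]
      simp only [Measure.mapₗ_apply_of_measurable hp.measurable, hk]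
      simp only [Finset.sum_const, Finset.card_range]
      rw [← Nat.cast_smul_eq_nsmul ℝ≥0∞, smul_smul, ENNReal.inv_mul_cancel (by simp) (by finiteness),
        one_smul]
    have : μ.map hp.measurable.aemeasurable = N := by
      refine tendsto_nhds_unique hc ?_
      refine tendsto_const_nhds.congr fun n => (he n).symm
    exact congrArg Subtype.val this
  · refine le_of_tendsto (hint' φ hφ) (Eventually.of_forall fun n => ?_)
    exact mul_nonpos_of_nonneg_of_nonpos (by positivity) (hneg _)

lemma exists_ergodic {G : X → X} (hG : Continuous G) {p : X → Y} (hp : Continuous p)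
    {σ : Y → Y} (hpG : ∀ x, p (G x) = σ (p x)) {ν : Measure Y} 
    (hσ : Ergodic σ ν) (m : Measure X) [IsProbabilityMeasure m] (hm : m.map p = ν)
    {φ : X → ℝ} (hφ : Continuous φ)
    (hneg : ∀ n, ∑ k ∈ Finset.range n, ∫ x, φ (G^[k] x) ∂m ≤ 0) :
    ∃ μ : Measure X, IsProbabilityMeasure μ ∧ Ergodic G μ ∧ μ.map p = ν ∧
      ∫ x, φ x ∂μ ≤ 0 := by
  obtain ⟨μ₀, h1, h2, h3⟩ := exists_invariant hG hp hpG hσ.toMeasurePreserving m hm hφ hneg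
  have hν : IsProbabilityMeasure ν := by
    rw [← hm]; exact Measure.isProbabilityMeasure_map hp.measurable.aemeasurable
  let K : Set (ProbabilityMeasure X) :=
    {μ | (μ : Measure X).map G = μ ∧ (μ : Measure X).map p = ν}
  have hKc : IsClosed K := by
    have e : K = {μ | μ.map hG.measurable.aemeasurable = μ} ∩
        {μ | μ.map hp.measurable.aemeasurable = ⟨ν, hν⟩} := by
      ext μ
      exact ⟨fun h => ⟨Subtype.ext h.1, Subtype.ext h.2⟩,
        fun h => ⟨congrArg Subtype.val h.1, congrArg Subtype.val h.2⟩⟩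
    rw [e]
    exact (isClosed_eq (ProbabilityMeasure.continuous_map hG) continuous_id).inter
      (isClosed_eq (ProbabilityMeasure.continuous_map hp) continuous_const)
  have hJ : Continuous (fun μ : ProbabilityMeasure X => ∫ x, φ x ∂(μ : Measure X)) :=
    ProbabilityMeasure.continuous_integral_continuousMap (⟨φ, hφ⟩ : C(X, ℝ))
  obtain ⟨μ₁, hμ₁, hmin⟩ := hKc.isCompact.exists_isMinOn ⟨μ₀, h1, h2⟩ hJ.continuousOn
  set c := ∫ x, φ x ∂(μ₁ : Measure X) with hc
  have hmin' : ∀ μ ∈ K, c ≤ ∫ x, φ x ∂(μ : Measure X) := fun μ hμ => hmin hμ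
  have hc0 : c ≤ 0 := (hmin' μ₀ ⟨h1, h2⟩).trans h3
  let K' : Set (ProbabilityMeasure X) := K ∩ {μ | ∫ x, φ x ∂(μ : Measure X) = c}
  have hK'c : IsCompact K' := (hKc.inter (isClosed_eq hJ continuous_const)).isCompact
  let Φ : ProbabilityMeasure X → (C(X, ℝ) → ℝ) := fun μ g => ∫ x, g x ∂(μ : Measure X)
  have hΦ : Continuous Φ := continuous_pi fun g =>
    ProbabilityMeasure.continuous_integral_continuousMap g
  have hΦinj : Function.Injective Φ := by
    intro μ μ' h
    apply Subtype.ext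
    have := μ.2
    have := μ'.2
    apply ext_of_forall_integral_eq_of_IsFiniteMeasure
    intro f
    exact congrFun h f.toContinuousMap
  obtain ⟨_, ⟨μ, hμ, rfl⟩, hext⟩ := (hK'c.image hΦ).extremePoints_nonempty ⟨_, μ₁, ⟨hμ₁, rfl⟩, rfl⟩
  refine ⟨μ, inferInstance, ?_, hμ.1.2, hμ.2.le.trans hc0⟩
  apply Ergodic.of_mem_extremePoints
  rw [mem_extremePoints_iff_left]
  refine ⟨⟨⟨hG.measurable, hμ.1.1⟩, inferInstance⟩, ?_⟩
  rintro ν₁ ⟨hG1, hp1⟩ ν₂ ⟨hG2, hp2⟩ ⟨a, b, ha, hb, hab, hsum⟩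
  have ha1 : a ≠ ∞ := by rintro rfl; simp at hab
  have hb1 : b ≠ ∞ := by rintro rfl; simp at hab
  have key : ∀ (κ : Measure X) [IsProbabilityMeasure κ], MeasurePreserving G κ κ → κ ≪ μ →
      κ.map p = ν := by
    intro κ _ hκ hac
    have := Measure.isProbabilityMeasure_map (μ := κ) hp.measurable.aemeasurable
    apply hσ.eq_of_absolutelyContinuous
    · refine ⟨hσ.measurable, ?_⟩
      rw [Measure.map_map hσ.measurable hp.measurable]
      have : σ ∘ p = p ∘ G := by funext x; exact (hpG x).symm
      rw [this, ← Measure.map_map hp.measurable hG.measurable, hκ.map_eq]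
    · rw [← hμ.1.2]
      exact hac.map hp.measurable
  have k1 := key ν₁ hG1 (by
    rw [← hsum]; exact (Measure.absolutelyContinuous_smul ha.ne').add_right _)
  have k2 := key ν₂ hG2 (by
    rw [← hsum, add_comm]; exact (Measure.absolutelyContinuous_smul hb.ne').add_right _)
  let N1 : ProbabilityMeasure X := ⟨ν₁, hp1⟩
  let N2 : ProbabilityMeasure X := ⟨ν₂, hp2⟩
  have hN1 : N1 ∈ K := ⟨hG1.map_eq, k1⟩
  have hN2 : N2 ∈ K := ⟨hG2.map_eq, k2⟩
  have hab' : a.toReal + b.toReal = 1 := by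
    rw [← ENNReal.toReal_add ha1 hb1, hab]; simp
  have ha' : 0 < a.toReal := ENNReal.toReal_pos ha.ne' ha1
  have hb' : 0 < b.toReal := ENNReal.toReal_pos hb.ne' hb1
  have hcomb : ∀ g : X → ℝ, Continuous g → ∫ x, g x ∂(μ : Measure X) =
      a.toReal * ∫ x, g x ∂ν₁ + b.toReal * ∫ x, g x ∂ν₂ := by
    intro g hg
    have i1 : Integrable g ν₁ := hg.integrable_of_hasCompactSupport (HasCompactSupport.of_compactSpace _)
    have i2 : Integrable g ν₂ := hg.integrable_of_hasCompactSupport (HasCompactSupport.of_compactSpace _)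
    rw [← hsum, integral_add_measure (i1.smul_measure ha1) (i2.smul_measure hb1),
      integral_smul_measure, integral_smul_measure, smul_eq_mul, smul_eq_mul]
  have c1 : c ≤ ∫ x, φ x ∂ν₁ := hmin' N1 hN1
  have c2 : c ≤ ∫ x, φ x ∂ν₂ := hmin' N2 hN2
  have c3 := hcomb φ hφ
  rw [hμ.2] at c3
  have e1 : ∫ x, φ x ∂ν₁ = c := by nlinarith
  have e2 : ∫ x, φ x ∂ν₂ = c := by nlinarith
  have := hext ⟨N1, ⟨hN1, e1⟩, rfl⟩ ⟨N2, ⟨hN2, e2⟩, rfl⟩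
    ⟨a.toReal, b.toReal, ha', hb', hab', by
      funext g
      exact (hcomb g g.continuous).symm⟩
  exact congrArg Subtype.val (hΦinj this)
end aux

section bern
open ProbabilityTheory
open scoped ENNReal
/-- uniform measure -/
def unif3 : Measure (Fin 3) := uniformOn univ
instance : IsProbabilityMeasure unif3 := by
  unfold unif3; exact isProbabilityMeasure_uniformOn finite_univ univ_nonempty
/-- Bernoulli measure -/
def bern3 : Measure Sig3 := Measure.infinitePi (fun _ : ℤ => unif3)
instance : IsProbabilityMeasure bern3 := by unfold bern3; infer_instance

lemma unif3_singleton (a : Fin 3) : unif3 {a} = ENNReal.ofReal (1/3) := by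
  unfold unif3
  rw [uniformOn_univ]
  simp

lemma bern3_isBernoulli : IsBernoulli (fun _ => (1:ℝ)/3) bern3 := by
  refine ⟨inferInstance, fun s a => ?_⟩
  have : {ξ : Sig3 | ∀ i ∈ s, ξ i = a i} = Set.pi s (fun i => {a i}) := by
    ext ξ; simp
  rw [this, bern3, Measure.infinitePi_pi _ (fun i _ => measurableSet_singleton _)]
  simp only [unif3_singleton]
  rw [ENNReal.ofReal_prod_of_nonneg (fun _ _ => by norm_num)]

lemma measurable_shiftMap : Measurable shiftMap := by
  unfold shiftMap; fun_prop

lemma shift_mp : MeasurePreserving shiftMap bern3 bern3 := by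
  refine ⟨measurable_shiftMap, ?_⟩
  exact Measure.map_infinitePi_infinitePi_of_inj (P := fun _ : ℤ => unif3)
    (f := fun i : ℤ => i + 1) (add_left_injective 1)

lemma shift_iter (n : ℕ) (ξ : Sig3) (i : ℤ) : shiftMap^[n] ξ i = ξ (i + n) := by
  induction n generalizing ξ with
  | zero => simp
  | succ n ih =>
    rw [Function.iterate_succ_apply, ih]
    simp only [shiftMap]; congr 1; push_cast; ring

lemma bern3_indep {B : Set Sig3} (hB : B ∈ measurableCylinders (fun _ : ℤ => Fin 3)) :
    ∃ n : ℕ, bern3 (B ∩ shiftMap^[n] ⁻¹' B) = bern3 B * bern3 B := by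
  obtain ⟨t, C, hC, rfl⟩ := (mem_measurableCylinders _).1 hB
  obtain ⟨M, hM⟩ : ∃ M : ℕ, ∀ i ∈ t, |i| ≤ M := by
    refine ⟨∑ i ∈ t, i.natAbs, fun i hi => ?_⟩
    rw [Int.abs_eq_natAbs]
    exact_mod_cast Finset.single_le_sum (f := fun i : ℤ => i.natAbs) (fun _ _ => Nat.zero_le _) hi
  let n : ℕ := 2 * M + 1
  refine ⟨n, ?_⟩
  let T : Finset ℤ := t.image (fun i => i + n)
  have hdisj : Disjoint t T := by
    rw [Finset.disjoint_left]
    intro i hi hiT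
    obtain ⟨j, hj, rfl⟩ := Finset.mem_image.1 hiT
    have h1 := abs_le.1 (hM _ hi)
    have h2 := abs_le.1 (hM _ hj)
    simp only [n] at h1
    push_cast at h1
    lia
  have hind : iIndepFun (fun (i : ℤ) (ξ : Sig3) => ξ i) bern3 :=
    iIndepFun_infinitePi (P := fun _ : ℤ => unif3) (X := fun _ x => x) (fun _ => measurable_id)
  have h2 := hind.indepFun_finset t T hdisj (fun i => measurable_pi_apply i)
  let r : (T → Fin 3) → (t → Fin 3) := fun ξ i => ξ ⟨i + n, Finset.mem_image_of_mem _ i.2⟩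
  have hr : Measurable r := by fun_prop
  have h3 := h2.comp measurable_id hr
  have h4 := h3.measure_inter_preimage_eq_mul C C hC hC
  have e1 : (id ∘ fun (a : Sig3) (i : t) => a i) ⁻¹' C = cylinder t C := rfl
  have e2 : (r ∘ fun (a : Sig3) (i : T) => a i) ⁻¹' C = shiftMap^[n] ⁻¹' (cylinder t C) := by
    have : (r ∘ fun (a : Sig3) (i : T) => a i) = t.restrict ∘ shiftMap^[n] := by
      funext ξ i
      simp [r, shift_iter, Finset.restrict]
    rw [this]; rfl
  rw [e1, e2] at h4
  rw [h4, (shift_mp.iterate n).measure_preimage (MeasurableSet.cylinder t hC).nullMeasurableSet]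

lemma shift_ergodic : Ergodic shiftMap bern3 := by
  refine ⟨shift_mp, ⟨fun A hA hinv => ?_⟩⟩
  have hinvn : ∀ n : ℕ, shiftMap^[n] ⁻¹' A = A := fun n => by
    induction n with
    | zero => rfl
    | succ n ih => rw [Function.iterate_succ, preimage_comp, ih, hinv]
  have key : ∀ ε : ℝ, 0 < ε → |bern3.real A - bern3.real A ^ 2| ≤ 4 * ε := by
    intro ε hε
    obtain ⟨B, hB, hlt⟩ := exists_measure_symmDiff_lt_of_generateFrom_isSetRing (μ := bern3)
      (C := measurableCylinders (fun _ : ℤ => Fin 3))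
      isSetRing_measurableCylinders
      ⟨{univ}, countable_singleton _, singleton_subset_iff.2 (univ_mem_measurableCylinders _), by simp⟩
      generateFrom_measurableCylinders.symm hA (ENNReal.ofReal_pos.2 hε)
    have hBm : MeasurableSet B := MeasurableSet.of_mem_measurableCylinders hB
    obtain ⟨n, hn⟩ := bern3_indep hB
    set Bn := shiftMap^[n] ⁻¹' B with hBn
    have hBnm : MeasurableSet Bn := (shift_mp.iterate n).measurable hBm
    have h1 : bern3.real (symmDiff B A) ≤ ε :=
      ENNReal.toReal_le_of_le_ofReal hε.le hlt.le
    have h2 : bern3.real (symmDiff Bn A) ≤ ε := by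
      have : symmDiff Bn A = shiftMap^[n] ⁻¹' (symmDiff B A) := by
        rw [preimage_symmDiff, hinvn]
      rw [this, (shift_mp.iterate n).measureReal_preimage (hBm.symmDiff hA).nullMeasurableSet]
      exact h1
    have h3 : bern3.real (symmDiff (B ∩ Bn) A) ≤ 2 * ε := by
      have : symmDiff (B ∩ Bn) A ⊆ symmDiff B A ∪ symmDiff Bn A := by
        intro x hx
        simp only [mem_symmDiff, mem_union, mem_inter_iff] at hx ⊢
        tauto
      have := (measureReal_mono (μ := bern3) this).trans (measureReal_union_le _ _)
      linarith
    have h4 : bern3.real (B ∩ Bn) = bern3.real B ^ 2 := by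
      simp only [measureReal_def, hn, ENNReal.toReal_mul]; ring
    have h5 := (abs_measureReal_sub_le_measureReal_symmDiff (μ := bern3) hBm.nullMeasurableSet hA.nullMeasurableSet).trans h1
    have h6 := (abs_measureReal_sub_le_measureReal_symmDiff (μ := bern3) (hBm.inter hBnm).nullMeasurableSet hA.nullMeasurableSet).trans h3
    rw [h4] at h6
    have b0 : 0 ≤ bern3.real B := measureReal_nonneg
    have b1 : bern3.real B ≤ 1 := measureReal_le_one
    have a0 : 0 ≤ bern3.real A := measureReal_nonneg
    have a1 : bern3.real A ≤ 1 := measureReal_le_one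
    rw [abs_le] at *
    constructor <;> nlinarith
  have h0 : bern3.real A - bern3.real A ^ 2 = 0 := by
    by_contra h
    have := key (|bern3.real A - bern3.real A ^ 2| / 8) (by positivity)
    have h' : 0 < |bern3.real A - bern3.real A ^ 2| := by positivity
    linarith
  have h1 : bern3.real A = 0 ∨ bern3.real A = 1 := by
    have : bern3.real A * (1 - bern3.real A) = 0 := by linarith
    rcases mul_eq_zero.1 this with h | h
    · exact Or.inl h
    · right; linarith
  rw [eventuallyConst_set]
  rcases h1 with h | h
  · right
    rw [measureReal_eq_zero_iff] at h
    simpa [ae_iff] using! h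
  · left
    have : bern3.real Aᶜ = 0 := by rw [probReal_compl_eq_one_sub hA, h, sub_self]
    rw [measureReal_eq_zero_iff] at this
    simpa [ae_iff] using! this
end bern

section main
/-- partial products of derivatives -/
def Dn (fs : Fin 3 → ℝ → ℝ) (ξ : ℕ → Fin 3) (n : ℕ) (x : ℝ) : ℝ :=
  ∏ k ∈ Finset.range n, deriv (fs (ξ k)) (seqComp fs ξ k x)

structure GoodFs (fs : Fin 3 → ℝ → ℝ) (e : Fin 3 → ℝ) : Prop where
  cd : ∀ i, ContDiff ℝ 1 (fs i)
  mt : ∀ i, MapsTo (fs i) (Icc 0 1) (Icc 0 1)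
  sg : ∀ i, |e i| = 1
  ps : ∀ i, ∀ x ∈ Icc (0:ℝ) 1, 0 < e i * deriv (fs i) x

variable {fs : Fin 3 → ℝ → ℝ} {e : Fin 3 → ℝ}

lemma GoodFs.hasDeriv (h : GoodFs fs e) (ξ : ℕ → Fin 3) (n : ℕ) (x : ℝ) :
    HasDerivAt (seqComp fs ξ n) (Dn fs ξ n x) x := by
  induction n with
  | zero => simpa [Dn, seqComp] using hasDerivAt_id x
  | succ n ih =>
    have h1 : HasDerivAt (fs (ξ n)) (deriv (fs (ξ n)) (seqComp fs ξ n x)) (seqComp fs ξ n x) :=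
      (((h.cd (ξ n)).differentiable (by norm_num)) _).hasDerivAt
    have := h1.comp x ih
    rw [Dn, Finset.prod_range_succ, mul_comm]
    exact this

lemma GoodFs.cont (h : GoodFs fs e) (ξ : ℕ → Fin 3) (n : ℕ) : Continuous (seqComp fs ξ n) :=
  continuous_iff_continuousAt.2 fun x => (h.hasDeriv ξ n x).continuousAt

lemma GoodFs.contD (h : GoodFs fs e) (ξ : ℕ → Fin 3) (n : ℕ) : Continuous (Dn fs ξ n) := by
  unfold Dn
  refine continuous_finsetProd _ fun k _ => ?_
  exact ((h.cd (ξ k)).continuous_deriv le_rfl).comp (h.cont ξ k)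

lemma GoodFs.maps (h : GoodFs fs e) (ξ : ℕ → Fin 3) (n : ℕ) :
    MapsTo (seqComp fs ξ n) (Icc 0 1) (Icc 0 1) := by
  induction n with
  | zero => exact fun x hx => hx
  | succ n ih => exact fun x hx => h.mt _ (ih hx)

lemma GoodFs.sum_log_le (h : GoodFs fs e) (ξ : ℕ → Fin 3) (n : ℕ) {x : ℝ} (hx : x ∈ Icc (0:ℝ) 1) :
    ∑ k ∈ Finset.range n, Real.log |deriv (fs (ξ k)) (seqComp fs ξ k x)| ≤
      (∏ k ∈ Finset.range n, e (ξ k)) * Dn fs ξ n x - 1 := by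
  have hp : ∀ k, 0 < e (ξ k) * deriv (fs (ξ k)) (seqComp fs ξ k x) :=
    fun k => h.ps _ _ (h.maps ξ k hx)
  have ha : ∀ k, |deriv (fs (ξ k)) (seqComp fs ξ k x)| = 
      e (ξ k) * deriv (fs (ξ k)) (seqComp fs ξ k x) := fun k => by
    rw [← abs_of_pos (hp k), abs_mul, h.sg, one_mul]
  simp only [ha]
  rw [← Real.log_prod (fun k _ => (hp k).ne'), Dn, ← Finset.prod_mul_distrib]
  exact Real.log_le_sub_one_of_pos (Finset.prod_pos fun k _ => hp k)

lemma GoodFs.integral_le (h : GoodFs fs e) (ξ : ℕ → Fin 3) (n : ℕ) :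
    ∫ x : Icc (0:ℝ) 1, ((∏ k ∈ Finset.range n, e (ξ k)) * Dn fs ξ n x - 1) ≤ 0 := by
  rw [integral_subtype measurableSet_Icc
    (fun x : ℝ => (∏ k ∈ Finset.range n, e (ξ k)) * Dn fs ξ n x - 1),
    integral_Icc_eq_integral_Ioc, ← intervalIntegral.integral_of_le zero_le_one,
    intervalIntegral.integral_sub
      (f := fun x => (∏ k ∈ Finset.range n, e (ξ k)) * Dn fs ξ n x) (g := fun _ => (1:ℝ))
      ((continuous_const.mul (h.contD ξ n)).intervalIntegrable _ _) (by simp),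
    intervalIntegral.integral_const_mul,
    intervalIntegral.integral_eq_sub_of_hasDerivAt (fun x _ => h.hasDeriv ξ n x)
      ((h.contD ξ n).intervalIntegrable _ _)]
  have hE : |∏ k ∈ Finset.range n, e (ξ k)| = 1 := by
    rw [Finset.abs_prod]; exact Finset.prod_eq_one fun k _ => h.sg _
  have h1 := h.maps ξ n (show (1:ℝ) ∈ Icc (0:ℝ) 1 by simp)
  have h0 := h.maps ξ n (show (0:ℝ) ∈ Icc (0:ℝ) 1 by simp)
  have h2 : |seqComp fs ξ n 1 - seqComp fs ξ n 0| ≤ 1 := by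
    rw [abs_le]; constructor <;> linarith [h1.1, h1.2, h0.1, h0.2]
  have h3 := le_abs_self ((∏ k ∈ Finset.range n, e (ξ k)) * (seqComp fs ξ n 1 - seqComp fs ξ n 0))
  rw [abs_mul, hE, one_mul] at h3
  simp
  linarith

lemma GoodFs.iter (h : GoodFs fs e) (n : ℕ) (p : XSp) :
    ((Gmap fs)^[n] p).1 = shiftMap^[n] p.1 ∧
      (((Gmap fs)^[n] p).2 : ℝ) = seqComp fs (fun k : ℕ => p.1 k) n p.2 := by
  induction n with
  | zero => exact ⟨rfl, rfl⟩
  | succ n ih =>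
    rw [Function.iterate_succ_apply', Function.iterate_succ_apply']
    refine ⟨congrArg shiftMap ih.1, ?_⟩
    simp only [Gmap, seqComp]
    rw [ih.1, ih.2, shift_iter, zero_add]
    exact congrArg Subtype.val (projIcc_of_mem _ (h.mt _ (h.maps (fun k : ℕ => p.1 k) n p.2.2)))

lemma cont_fam {Z : Type*} [TopologicalSpace Z] (g : Fin 3 → ℝ → Z) (hg : ∀ i, Continuous (g i)) :
    Continuous (fun p : XSp => g (p.1 0) (p.2 : ℝ)) := by
  have h1 : Continuous (fun q : Fin 3 × ℝ => g q.1 q.2) :=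
    continuous_prod_of_discrete_left.2 hg
  have h2 : Continuous (fun p : XSp => ((p.1 0, (p.2 : ℝ)) : Fin 3 × ℝ)) := by fun_prop
  exact h1.comp h2

lemma GoodFs.contG (h : GoodFs fs e) : Continuous (Gmap fs) := by
  have h1 : Continuous shiftMap := continuous_pi fun i => continuous_apply _
  exact (h1.comp continuous_fst).prodMk (continuous_projIcc.comp
    (cont_fam fs fun i => (h.cd i).continuous))

lemma GoodFs.contPhi (h : GoodFs fs e) : Continuous (phiC fs) := by
  have h1 := cont_fam (fun i x => |deriv (fs i) x|)
    (fun i => ((h.cd i).continuous_deriv le_rfl).abs)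
  refine Continuous.log h1 fun p => ?_
  rw [abs_ne_zero]
  exact right_ne_zero_of_mul (h.ps (p.1 0) p.2 p.2.2).ne'

lemma GoodFs.neg (h : GoodFs fs e) (n : ℕ) :
    ∑ k ∈ Finset.range n, ∫ p, phiC fs ((Gmap fs)^[k] p) 
      ∂(bern3.prod (volume : Measure (Icc (0:ℝ) 1))) ≤ 0 := by
  have hc : ∀ k, Continuous (fun p => phiC fs ((Gmap fs)^[k] p)) :=
    fun k => h.contPhi.comp (h.contG.iterate k)
  have hi : ∀ k, Integrable (fun p => phiC fs ((Gmap fs)^[k] p))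
      (bern3.prod (volume : Measure (Icc (0:ℝ) 1))) := fun k =>
    (hc k).integrable_of_hasCompactSupport (HasCompactSupport.of_compactSpace _)
  rw [← integral_finsetSum _ (fun k _ => hi k), integral_prod _ (integrable_finsetSum _ fun k _ => hi k)]
  refine integral_nonpos fun ξ => ?_
  refine le_trans (integral_mono ?_ ?_ fun x => ?_) (h.integral_le (fun k : ℕ => ξ k) n)
  · refine Continuous.integrable_of_hasCompactSupport ?_ (HasCompactSupport.of_compactSpace _)
    exact continuous_finsetSum _ fun k _ => (hc k).comp (by fun_prop)
  · refine Continuous.integrable_of_hasCompactSupport ?_ (HasCompactSupport.of_compactSpace _)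
    have := h.contD (fun k : ℕ => ξ k) n
    fun_prop
  · refine le_trans (le_of_eq ?_) (h.sum_log_le (fun k : ℕ => ξ k) n x.2)
    refine Finset.sum_congr rfl fun k _ => ?_
    obtain ⟨h1, h2⟩ := h.iter k (ξ, x)
    rw [phiC, h1, h2, shift_iter, zero_add]

lemma LamG_full (h : GoodFs fs e) (μ : Measure XSp) [IsProbabilityMeasure μ]
    (hμ : MeasurePreserving (Gmap fs) μ μ) : μ (LamG fs) = 1 := by
  have hcl : ∀ n : ℕ, MeasurableSet ((Gmap fs)^[n] '' univ) := fun n =>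
    (isCompact_univ.image (h.contG.iterate n)).isClosed.measurableSet
  have h1 : ∀ n : ℕ, (Gmap fs)^[n] '' univ ∈ ae μ := fun n => by
    rw [mem_ae_iff_prob_eq_one (hcl n),
      ← (hμ.iterate n).measure_preimage (hcl n).nullMeasurableSet]
    have : (Gmap fs)^[n] ⁻¹' ((Gmap fs)^[n] '' univ) = univ :=
      eq_univ_of_forall fun x => ⟨x, trivial, rfl⟩
    rw [this, measure_univ]
  refine (mem_ae_iff_prob_eq_one (MeasurableSet.iInter hcl)).1 ?_
  exact countable_iInter_mem.2 h1

end main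

/-- there is an ergodic `G`-invariant probability measure on `Λ_G`
projecting to the `(1/3,1/3,1/3)`-Bernoulli measure with nonpositive central exponent. -/
theorem stmt12 (f₀ f₁ f₂ : ℝ → ℝ) (β₀ lam₀ γ β₂ : ℝ)
    (h0 : F0cond f₀ β₀ lam₀) (h1 : F1cond f₁ γ lam₀) (h2 : F2cond f₂ β₂ lam₀) :
    ∃ μ : Measure XSp, IsProbabilityMeasure μ ∧ Ergodic (Gmap ![f₀, f₁, f₂]) μ ∧
      μ (LamG ![f₀, f₁, f₂]) = 1 ∧
      IsBernoulli (fun _ => (1:ℝ)/3) (μ.map Prod.fst) ∧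
      chiOf ![f₀, f₁, f₂] μ ≤ 0 := by
  obtain ⟨a1, a2, a3, a4, a5, a6, a7, a8, a9, a10, a11, a12⟩ := h0
  obtain ⟨b1, b2, b3⟩ := h1
  obtain ⟨c1, c2, c3, c4, c5, c6, c7, -⟩ := h2
  have hγ : 0 < γ := a10.trans_le b2
  have hf1 : f₁ = fun x => γ * (1 - x) := funext b1
  have good : GoodFs ![f₀, f₁, f₂] ![1, -1, 1] := by
    refine ⟨fun i => ?_, fun i => ?_, fun i => ?_, fun i x hx => ?_⟩
    · fin_cases i
      · exact a1
      · show ContDiff ℝ 1 f₁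
        rw [hf1]; fun_prop
      · exact c1
    · fin_cases i
      · exact a2
      · intro x hx
        show f₁ x ∈ _
        rw [b1]
        constructor <;> nlinarith [hx.1, hx.2]
      · exact c2
    · fin_cases i <;> simp
    · fin_cases i
      · simpa using a10.trans_le (a12 x hx)
      · show 0 < (-1 : ℝ) * deriv f₁ x
        have : HasDerivAt f₁ (γ * (-1)) x := by
          rw [hf1]; exact ((hasDerivAt_id x).const_sub 1).const_mul γ
        rw [this.deriv]; linarith
      · simpa using a10.trans_le (c7 x hx)
  have hm : (bern3.prod (volume : Measure (Icc (0:ℝ) 1))).map Prod.fst = bern3 := by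
    rw [Measure.map_fst_prod]; simp
  obtain ⟨μ, i1, i2, i3, i4⟩ := exists_ergodic good.contG (p := Prod.fst) continuous_fst
    (σ := shiftMap) (fun _ => rfl) shift_ergodic _ hm good.contPhi good.neg
  exact ⟨μ, i1, i2, LamG_full good μ i2.toMeasurePreserving, i3 ▸ bern3_isBernoulli, i4⟩

end
end

section
/- (Lifts of Bernoulli measures.) Assume (F0), (F1) and (F2), and assume f₀'(x) ≤ β⁺ and f₂'(x) ≤ β⁺ for all x∈[0,1]. Let (p₀,p₁,p₂) be a probability vector and let ν be the (p₀,p₁,p₂)-Bernoulli measure on Σ₃. Then: (i) there exists a G-invariant Borel probability measure μ with π⁎μ = ν and χ(μ) ≤ 0; (ii) every G-invariant Borel probability measure μ with π⁎μ = ν satisfies χ(μ) ≤ p₁·log γ + (p₀+p₂)·log β⁺. -/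
open Set Filter MeasureTheory

noncomputable section

theorem kb_limit {X : Type*} [TopologicalSpace X] [CompactSpace X] [T2Space X]
    [TopologicalSpace.PseudoMetrizableSpace X]
    [MeasurableSpace X] [BorelSpace X] (G : X → X) (hG : Continuous G)
    (m : Measure X) [IsProbabilityMeasure m] (φ : X → ℝ) (hφ : Continuous φ)
    (hneg : ∀ n : ℕ, ∑ k ∈ Finset.range n, ∫ x, φ (G^[k] x) ∂m ≤ 0) :
    ∃ μ : Measure X, IsProbabilityMeasure μ ∧ μ.map G = μ ∧ ∫ x, φ x ∂μ ≤ 0 ∧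
      ∀ g : X → ℝ, Continuous g → (∀ k : ℕ, ∫ x, g (G^[k] x) ∂m = ∫ x, g x ∂m) →
        ∫ x, g x ∂μ = ∫ x, g x ∂m := by
  classical
  have hGk : ∀ k, Continuous (G^[k]) := fun k => hG.iterate k
  have hint : ∀ (g : X → ℝ), Continuous g → ∀ (μ : Measure X) [IsFiniteMeasure μ],
      Integrable g μ := by
    intro g hg μ _
    exact (BoundedContinuousFunction.mkOfCompact ⟨g, hg⟩).integrable μ
  let M : ℕ → Measure X := fun n =>
    (ENNReal.ofReal ((n + 1 : ℝ)⁻¹)) • ∑ k ∈ Finset.range (n+1), m.map (G^[k])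
  have hprobk : ∀ k, IsProbabilityMeasure (m.map (G^[k])) := fun k =>
    Measure.isProbabilityMeasure_map (hGk k).aemeasurable
  have hM : ∀ n, IsProbabilityMeasure (M n) := by
    intro n
    refine ⟨?_⟩
    simp only [M, Measure.smul_apply, Measure.coe_finsetSum, Finset.sum_apply, measure_univ,
      Finset.sum_const, Finset.card_range, smul_eq_mul, nsmul_eq_mul, mul_one]
    rw [← ENNReal.ofReal_natCast, ← ENNReal.ofReal_mul (by positivity)]
    push_cast
    rw [inv_mul_cancel₀ (by positivity)]
    simp
  have hMint : ∀ n (g : X → ℝ), Continuous g →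
      ∫ x, g x ∂(M n) = (n + 1 : ℝ)⁻¹ * ∑ k ∈ Finset.range (n+1), ∫ x, g (G^[k] x) ∂m := by
    intro n g hg
    simp only [M]
    rw [integral_smul_measure, integral_finsetSum_measure (fun k _ => hint g hg _),
      ENNReal.toReal_ofReal (by positivity), smul_eq_mul]
    congr 1
    refine Finset.sum_congr rfl fun k _ => ?_
    rw [integral_map (hGk k).aemeasurable hg.aestronglyMeasurable]
  let P : ℕ → ProbabilityMeasure X := fun n => ⟨M n, hM n⟩
  let U : Ultrafilter ℕ := Ultrafilter.of atTop
  have hU : (U : Filter ℕ) ≤ atTop := Ultrafilter.of_le atTop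
  obtain ⟨μ, -, hμ⟩ := isCompact_univ.ultrafilter_le_nhds (U.map P) (by simp)
  have hlim : ∀ g : X → ℝ, Continuous g →
      Tendsto (fun n => ∫ x, g x ∂(M n)) U (nhds (∫ x, g x ∂(μ : Measure X))) := by
    intro g hg
    have := (ProbabilityMeasure.tendsto_iff_forall_integral_tendsto (F := (U : Filter ℕ))
      (μs := P) (μ := μ)).1 hμ (BoundedContinuousFunction.mkOfCompact ⟨g, hg⟩)
    exact this
  refine ⟨μ, inferInstance, ?_, ?_, ?_⟩
  · have : IsProbabilityMeasure ((μ : Measure X).map G) :=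
      Measure.isProbabilityMeasure_map hG.aemeasurable
    refine ext_of_forall_integral_eq_of_IsFiniteMeasure fun g => ?_
    rw [integral_map hG.aemeasurable g.continuous.aestronglyMeasurable]
    have h1 := (hlim _ (g.continuous.comp hG)).sub (hlim _ g.continuous)
    have h2 : Tendsto (fun n => ∫ x, (g ∘ G) x ∂(M n) - ∫ x, g x ∂(M n)) U (nhds 0) := by
      refine Tendsto.mono_left ?_ hU
      have hb : ∀ n : ℕ, ‖∫ x, (g ∘ G) x ∂(M n) - ∫ x, g x ∂(M n)‖ ≤
          (2 * ‖g‖) * (1 / ((n : ℝ) + 1)) := by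
        intro n
        rw [hMint n _ (g.continuous.comp hG), hMint n _ g.continuous, ← mul_sub,
          ← Finset.sum_sub_distrib]
        have : ∀ k, ∫ x, (g ∘ G) (G^[k] x) ∂m = ∫ x, g (G^[k+1] x) ∂m := by
          intro k; simp only [Function.comp, Function.iterate_succ_apply']
        simp only [this]
        rw [Finset.sum_range_sub (fun k => ∫ x, g (G^[k] x) ∂m), norm_mul, mul_comm,
          Real.norm_of_nonneg (by positivity : (0:ℝ) ≤ ((n:ℝ)+1)⁻¹), one_div]
        gcongr
        refine (norm_sub_le _ _).trans ?_
        have hk : ∀ k, ‖∫ x, g (G^[k] x) ∂m‖ ≤ ‖g‖ := by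
          intro k
          have := norm_integral_le_of_norm_le_const (μ := m) (f := fun x => g (G^[k] x))
            (C := ‖g‖) (Eventually.of_forall fun x => g.norm_coe_le_norm _)
          simpa using this
        linarith [hk (n+1), hk 0]
      refine squeeze_zero_norm hb ?_
      simpa using (tendsto_one_div_add_atTop_nhds_zero_nat (𝕜 := ℝ)).const_mul (2 * ‖g‖)
    have := tendsto_nhds_unique h1 h2
    simp only [Function.comp] at this
    linarith
  · refine le_of_tendsto (hlim φ hφ) (Eventually.of_forall fun n => ?_)
    rw [hMint n φ hφ]
    exact mul_nonpos_of_nonneg_of_nonpos (by positivity) (hneg _)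
  · intro g hg hk
    refine tendsto_nhds_unique (hlim g hg) ?_
    refine tendsto_const_nhds.congr fun n => ?_
    rw [hMint n g hg]
    simp only [hk, Finset.sum_const, Finset.card_range, nsmul_eq_mul]
    push_cast
    field_simp

theorem aux_sc_contDiff (fs : Fin 3 → ℝ → ℝ) (hA : ∀ i, ContDiff ℝ 1 (fs i)) (ξ : ℕ → Fin 3)
    (n : ℕ) : ContDiff ℝ 1 (seqComp fs ξ n) := by
  induction n with
  | zero => exact contDiff_id
  | succ n ih => exact (hA _).comp ih

theorem aux_sc_mapsTo (fs : Fin 3 → ℝ → ℝ)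
    (hB : ∀ i, Set.MapsTo (fs i) (Set.Icc 0 1) (Set.Icc 0 1)) (ξ : ℕ → Fin 3)
    (n : ℕ) : Set.MapsTo (seqComp fs ξ n) (Set.Icc 0 1) (Set.Icc 0 1) := by
  induction n with
  | zero => exact Set.mapsTo_id _
  | succ n ih => exact (hB _).comp ih

theorem aux_sc_deriv (fs : Fin 3 → ℝ → ℝ) (hA : ∀ i, ContDiff ℝ 1 (fs i)) (ξ : ℕ → Fin 3)
    (n : ℕ) (x : ℝ) : deriv (seqComp fs ξ (n+1)) x =
      deriv (fs (ξ n)) (seqComp fs ξ n x) * deriv (seqComp fs ξ n) x := by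
  have h1 := ((hA (ξ n)).differentiable one_ne_zero) (seqComp fs ξ n x)
  have h2 := ((aux_sc_contDiff fs hA ξ n).differentiable one_ne_zero) x
  exact deriv_comp x h1 h2

theorem aux_sc_sign (fs : Fin 3 → ℝ → ℝ) (hA : ∀ i, ContDiff ℝ 1 (fs i))
    (hB : ∀ i, Set.MapsTo (fs i) (Set.Icc 0 1) (Set.Icc 0 1))
    (hC : ∀ i, (∀ x ∈ Set.Icc (0:ℝ) 1, 0 < deriv (fs i) x) ∨
      (∀ x ∈ Set.Icc (0:ℝ) 1, deriv (fs i) x < 0)) (ξ : ℕ → Fin 3)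
    (n : ℕ) : (∀ x ∈ Set.Icc (0:ℝ) 1, 0 < deriv (seqComp fs ξ n) x) ∨
      (∀ x ∈ Set.Icc (0:ℝ) 1, deriv (seqComp fs ξ n) x < 0) := by
  induction n with
  | zero => left; intro x _; simp [seqComp]
  | succ n ih =>
    have hm := aux_sc_mapsTo fs hB ξ n
    simp only [aux_sc_deriv fs hA]
    rcases ih with ih | ih <;> rcases hC (ξ n) with h | h
    · left; intro x hx; exact mul_pos (h _ (hm hx)) (ih x hx)
    · right; intro x hx; exact mul_neg_of_neg_of_pos (h _ (hm hx)) (ih x hx)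
    · right; intro x hx; exact mul_neg_of_pos_of_neg (h _ (hm hx)) (ih x hx)
    · left; intro x hx; exact mul_pos_of_neg_of_neg (h _ (hm hx)) (ih x hx)

theorem aux_sc_log (fs : Fin 3 → ℝ → ℝ) (hA : ∀ i, ContDiff ℝ 1 (fs i))
    (hB : ∀ i, Set.MapsTo (fs i) (Set.Icc 0 1) (Set.Icc 0 1))
    (hC : ∀ i, (∀ x ∈ Set.Icc (0:ℝ) 1, 0 < deriv (fs i) x) ∨
      (∀ x ∈ Set.Icc (0:ℝ) 1, deriv (fs i) x < 0)) (ξ : ℕ → Fin 3)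
    (n : ℕ) (x : ℝ) (hx : x ∈ Set.Icc (0:ℝ) 1) :
    ∑ k ∈ Finset.range n, Real.log |deriv (fs (ξ k)) (seqComp fs ξ k x)| =
      Real.log |deriv (seqComp fs ξ n) x| := by
  induction n with
  | zero => simp [seqComp]
  | succ n ih =>
    rw [Finset.sum_range_succ, ih, aux_sc_deriv fs hA, abs_mul, Real.log_mul, add_comm]
    · have := aux_sc_mapsTo fs hB ξ n hx
      rcases hC (ξ n) with h | h
      · exact abs_ne_zero.2 (h _ this).ne'
      · exact abs_ne_zero.2 (h _ this).ne
    · rcases aux_sc_sign fs hA hB hC ξ n with h | h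
      · exact abs_ne_zero.2 (h _ hx).ne'
      · exact abs_ne_zero.2 (h _ hx).ne

theorem aux_log_int (F : ℝ → ℝ) (hF : ContDiff ℝ 1 F)
    (hm : Set.MapsTo F (Set.Icc 0 1) (Set.Icc 0 1))
    (hs : (∀ x ∈ Set.Icc (0:ℝ) 1, 0 < deriv F x) ∨ (∀ x ∈ Set.Icc (0:ℝ) 1, deriv F x < 0)) :
    ∫ x : Set.Icc (0:ℝ) 1, Real.log |deriv F x| ≤ 0 := by
  have hne : ∀ x ∈ Set.Icc (0:ℝ) 1, |deriv F x| ≠ 0 := by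
    intro x hx
    rcases hs with h | h
    · exact abs_ne_zero.2 (h _ hx).ne'
    · exact abs_ne_zero.2 (h _ hx).ne
  have hdc : Continuous (deriv F) := hF.continuous_deriv le_rfl
  have e1 : ∫ x : Set.Icc (0:ℝ) 1, Real.log |deriv F x| =
      ∫ x in Set.Icc (0:ℝ) 1, Real.log |deriv F x| :=
    integral_subtype_comap measurableSet_Icc (fun x => Real.log |deriv F x|)
  have hmono : ∫ x in Set.Icc (0:ℝ) 1, Real.log |deriv F x| ≤
      ∫ x in Set.Icc (0:ℝ) 1, (|deriv F x| - 1) := by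
    refine setIntegral_mono_on ?_ ?_ measurableSet_Icc ?_
    · exact ContinuousOn.integrableOn_Icc (hdc.abs.continuousOn.log hne)
    · exact (hdc.abs.sub continuous_const).integrableOn_Icc
    · intro x hx
      exact Real.log_le_sub_one_of_pos (lt_of_le_of_ne (abs_nonneg _) (hne x hx).symm)
  have e2 : ∫ x in Set.Icc (0:ℝ) 1, (|deriv F x| - 1) = (∫ x in Set.Icc (0:ℝ) 1, |deriv F x|) - 1 := by
    rw [integral_sub (hdc.abs.integrableOn_Icc) (continuous_const.integrableOn_Icc)]
    simp
  have hint : ∫ x in (0:ℝ)..1, deriv F x = F 1 - F 0 :=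
    intervalIntegral.integral_deriv_eq_sub (fun x _ => hF.differentiable one_ne_zero x)
      (hdc.intervalIntegrable _ _)
  have hint2 : ∫ x in Set.Icc (0:ℝ) 1, deriv F x = F 1 - F 0 := by
    rw [integral_Icc_eq_integral_Ioc, ← intervalIntegral.integral_of_le zero_le_one, hint]
  have b0 := hm (Set.left_mem_Icc.2 zero_le_one)
  have b1 := hm (Set.right_mem_Icc.2 zero_le_one)
  have e3 : ∫ x in Set.Icc (0:ℝ) 1, |deriv F x| ≤ 1 := by
    rcases hs with h | h
    · rw [setIntegral_congr_fun measurableSet_Icc (g := deriv F)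
        (fun x hx => abs_of_pos (h x hx)), hint2]
      linarith [b0.1, b1.2]
    · rw [setIntegral_congr_fun measurableSet_Icc (g := fun x => - deriv F x)
        (fun x hx => abs_of_neg (h x hx)), integral_neg, hint2]
      linarith [b0.2, b1.1]
  linarith

theorem aux_cont_fin (g : Fin 3 → ℝ → ℝ)
    (hg : ∀ i, ContinuousOn (g i) (Set.Icc 0 1)) :
    Continuous (fun p : XSp => g (p.1 0) (p.2 : ℝ)) := by
  have h : Continuous (fun q : Fin 3 × Set.Icc (0:ℝ) 1 => g q.1 (q.2 : ℝ)) := by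
    rw [continuous_prod_of_discrete_left]
    intro i
    exact continuousOn_iff_continuous_domRestrict.1 (hg i)
  have h2 : Continuous (fun p : XSp => ((p.1 0, p.2) : Fin 3 × Set.Icc (0:ℝ) 1)) :=
    ((continuous_apply 0).comp continuous_fst).prodMk continuous_snd
  exact h.comp h2

theorem aux_shift_cont : Continuous shiftMap :=
  continuous_pi fun i => continuous_apply (i + 1)

theorem aux_G_cont (fs : Fin 3 → ℝ → ℝ) (hA : ∀ i, ContDiff ℝ 1 (fs i)) :
    Continuous (Gmap fs) := by
  refine (aux_shift_cont.comp continuous_fst).prodMk ?_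
  exact continuous_projIcc.comp (aux_cont_fin fs fun i => (hA i).continuous.continuousOn)

theorem aux_G_iter (fs : Fin 3 → ℝ → ℝ)
    (hB : ∀ i, Set.MapsTo (fs i) (Set.Icc 0 1) (Set.Icc 0 1)) (p : XSp) (k : ℕ) :
    ((Gmap fs)^[k] p).1 = (fun i => p.1 (i + k)) ∧
    (((Gmap fs)^[k] p).2 : ℝ) = seqComp fs (fun n => p.1 n) k p.2 := by
  induction k with
  | zero => simp [seqComp]
  | succ k ih =>
    rw [Function.iterate_succ_apply']
    obtain ⟨h1, h2⟩ := ih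
    constructor
    · funext i
      change ((Gmap fs)^[k] p).1 (i + 1) = _
      rw [h1]
      change p.1 (i + 1 + k) = p.1 (i + ((k + 1 : ℕ) : ℤ))
      congr 1
      push_cast
      ring
    · simp only [Gmap, h1, seqComp, h2, zero_add]
      rw [Set.projIcc_of_mem _ (hB _ (aux_sc_mapsTo fs hB _ k p.2.2))]

theorem aux_phi_cont (fs : Fin 3 → ℝ → ℝ) (hA : ∀ i, ContDiff ℝ 1 (fs i))
    (hC : ∀ i, (∀ x ∈ Set.Icc (0:ℝ) 1, 0 < deriv (fs i) x) ∨
      (∀ x ∈ Set.Icc (0:ℝ) 1, deriv (fs i) x < 0)) : Continuous (phiC fs) := by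
  refine aux_cont_fin (fun i x => Real.log |deriv (fs i) x|) fun i => ?_
  refine ((hA i).continuous_deriv le_rfl).abs.continuousOn.log fun x hx => ?_
  rcases hC i with h | h
  · exact abs_ne_zero.2 (h _ hx).ne'
  · exact abs_ne_zero.2 (h _ hx).ne

theorem aux_int {X : Type*} [TopologicalSpace X] [CompactSpace X] [MeasurableSpace X]
    [OpensMeasurableSpace X]
    (g : X → ℝ) (hg : Continuous g) (μ : Measure X) [IsFiniteMeasure μ] : Integrable g μ :=
  (BoundedContinuousFunction.mkOfCompact ⟨g, hg⟩).integrable μ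

theorem aux_shift_inv (p : Fin 3 → ℝ) (ν : Measure Sig3) (hν : IsBernoulli p ν) :
    ν.map shiftMap = ν := by
  obtain ⟨hpr, hcyl⟩ := hν
  have hmeas : Measurable shiftMap := measurable_pi_lambda _ fun i => measurable_pi_apply (i+1)
  have : IsProbabilityMeasure (ν.map shiftMap) := Measure.isProbabilityMeasure_map hmeas.aemeasurable
  let C : Set (Set Sig3) := {S | S = ∅ ∨ ∃ (s : Finset ℤ) (a : ℤ → Fin 3),
    S = {ξ | ∀ i ∈ s, ξ i = a i}}
  have hms : ∀ (s : Finset ℤ) (a : ℤ → Fin 3), MeasurableSet {ξ : Sig3 | ∀ i ∈ s, ξ i = a i} := by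
    intro s a
    have : {ξ : Sig3 | ∀ i ∈ s, ξ i = a i} = ⋂ i ∈ s, (fun ξ : Sig3 => ξ i) ⁻¹' {a i} := by
      ext ξ; simp
    rw [this]
    exact Finset.measurableSet_biInter _ fun i _ => measurable_pi_apply i (measurableSet_singleton _)
  refine ext_of_generate_finite C ?_ ?_ ?_ (by simp)
  · refine le_antisymm ?_ (MeasurableSpace.generateFrom_le ?_)
    · refine iSup_le fun i => ?_
      rw [← measurable_iff_comap_le]
      refine @measurable_to_countable' _ _ _ _ (MeasurableSpace.generateFrom C) _ fun a => ?_
      refine MeasurableSpace.measurableSet_generateFrom (Or.inr ⟨{i}, fun _ => a, ?_⟩)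
      ext ξ; simp
    · rintro S (rfl | ⟨s, a, rfl⟩)
      · exact MeasurableSet.empty
      · exact hms s a
  · rintro S hS T hT ⟨ξ, hξ⟩
    rcases hS with rfl | ⟨s, a, rfl⟩
    · simp at hξ
    rcases hT with rfl | ⟨t, b, rfl⟩
    · simp at hξ
    refine Or.inr ⟨s ∪ t, ξ, ?_⟩
    obtain ⟨h1, h2⟩ := hξ
    simp only [Set.mem_ofPred_eq] at h1 h2
    ext η
    simp only [Set.mem_inter_iff, Set.mem_ofPred_eq, Finset.mem_union]
    constructor
    · rintro ⟨k1, k2⟩ i (hi | hi)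
      · rw [k1 i hi, h1 i hi]
      · rw [k2 i hi, h2 i hi]
    · intro k
      exact ⟨fun i hi => by rw [k i (Or.inl hi), h1 i hi], fun i hi => by rw [k i (Or.inr hi), h2 i hi]⟩
  · rintro S (rfl | ⟨s, a, rfl⟩)
    · simp
    · rw [Measure.map_apply hmeas (hms s a), hcyl s a]
      have : shiftMap ⁻¹' {ξ : Sig3 | ∀ i ∈ s, ξ i = a i} =
          {ξ : Sig3 | ∀ i ∈ s.map (addRightEmbedding 1), ξ i = (fun j => a (j - 1)) i} := by
        ext ξ; simp [shiftMap]
      rw [this, hcyl, Finset.prod_map]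
      simp

theorem aux_eval_int (p : Fin 3 → ℝ) (hp : ∀ i, 0 ≤ p i) (ν : Measure Sig3)
    (hν : IsBernoulli p ν) (h : Fin 3 → ℝ) : ∫ ξ, h (ξ 0) ∂ν = ∑ i, p i * h i := by
  obtain ⟨hpr, hcyl⟩ := hν
  have hm : Measurable (fun ξ : Sig3 => ξ 0) := measurable_pi_apply 0
  have : IsProbabilityMeasure (ν.map (fun ξ : Sig3 => ξ 0)) :=
    Measure.isProbabilityMeasure_map hm.aemeasurable
  rw [← integral_map (φ := fun ξ : Sig3 => ξ 0) (f := h) hm.aemeasurable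
    (measurable_of_finite h).aestronglyMeasurable, integral_fintype .of_finite]
  refine Finset.sum_congr rfl fun i _ => ?_
  have e := hcyl {0} (fun _ => i)
  simp only [Finset.mem_singleton, forall_eq, Finset.prod_singleton] at e
  rw [Measure.real, Measure.map_apply hm (measurableSet_singleton _)]
  have e' : (fun ξ : Sig3 => ξ 0) ⁻¹' {i} = {ξ : Sig3 | ξ 0 = i} := rfl
  rw [e', e, ENNReal.toReal_ofReal (hp i), smul_eq_mul]

theorem aux_part1 (fs : Fin 3 → ℝ → ℝ) (hA : ∀ i, ContDiff ℝ 1 (fs i))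
    (hB : ∀ i, Set.MapsTo (fs i) (Set.Icc 0 1) (Set.Icc 0 1))
    (hC : ∀ i, (∀ x ∈ Set.Icc (0:ℝ) 1, 0 < deriv (fs i) x) ∨
      (∀ x ∈ Set.Icc (0:ℝ) 1, deriv (fs i) x < 0))
    (p : Fin 3 → ℝ) (ν : Measure Sig3) (hν : IsBernoulli p ν) :
    ∃ μ : Measure XSp, IsProbabilityMeasure μ ∧ μ.map (Gmap fs) = μ ∧
        μ.map Prod.fst = ν ∧ chiOf fs μ ≤ 0 := by
  have hpr := hν.1
  have hG := aux_G_cont fs hA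
  have hφ := aux_phi_cont fs hA hC
  have hinv := aux_shift_inv p ν hν
  let m : Measure XSp := ν.prod volume
  obtain ⟨μ, hμ, hμG, hμφ, hμg⟩ := kb_limit (Gmap fs) hG m (phiC fs) hφ (by
    intro n
    have hck : ∀ k, Continuous (fun q => phiC fs ((Gmap fs)^[k] q)) :=
      fun k => hφ.comp (hG.iterate k)
    rw [← integral_finsetSum _ (fun k _ => aux_int _ (hck k) m)]
    rw [integral_prod _ (aux_int _ (continuous_finsetSum _ fun k _ => hck k) m)]
    refine integral_nonpos fun ξ => ?_
    have : ∀ x : Set.Icc (0:ℝ) 1, ∑ k ∈ Finset.range n, phiC fs ((Gmap fs)^[k] (ξ, x)) =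
        Real.log |deriv (seqComp fs (fun n => ξ n) n) x| := by
      intro x
      rw [← aux_sc_log fs hA hB hC _ n x x.2]
      refine Finset.sum_congr rfl fun k _ => ?_
      obtain ⟨h1, h2⟩ := aux_G_iter fs hB (ξ, x) k
      simp only [phiC, h1, h2, zero_add]
    simp only [this]
    exact aux_log_int _ (aux_sc_contDiff fs hA _ n) (aux_sc_mapsTo fs hB _ n)
      (aux_sc_sign fs hA hB hC _ n))
  refine ⟨μ, hμ, hμG, ?_, hμφ⟩
  have : IsProbabilityMeasure (μ.map Prod.fst) :=
    Measure.isProbabilityMeasure_map measurable_fst.aemeasurable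
  refine ext_of_forall_integral_eq_of_IsFiniteMeasure fun g => ?_
  have hmf : m.map Prod.fst = ν := by
    change (ν.prod volume).fst = ν
    simp
  have hmi : ∀ h : Sig3 → ℝ, Continuous h → ∫ q, h q.1 ∂m = ∫ ξ, h ξ ∂ν := by
    intro h hh
    conv_rhs => rw [← hmf]
    rw [integral_map measurable_fst.aemeasurable hh.aestronglyMeasurable]
  rw [integral_map measurable_fst.aemeasurable g.continuous.aestronglyMeasurable,
    hμg (fun q => g q.1) (g.continuous.comp continuous_fst), hmi g g.continuous]
  intro k
  have hs : ∀ q : XSp, ((Gmap fs)^[k] q).1 = shiftMap^[k] q.1 := by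
    intro q
    induction k with
    | zero => rfl
    | succ k ih => rw [Function.iterate_succ_apply', Function.iterate_succ_apply', ← ih]; rfl
  simp only [hs]
  have hsk := aux_shift_cont.iterate k
  rw [hmi (fun ξ => g (shiftMap^[k] ξ)) (g.continuous.comp hsk), hmi g g.continuous]
  have hmp : MeasurePreserving shiftMap ν ν := ⟨aux_shift_cont.measurable, hinv⟩
  have := (hmp.iterate k).map_eq
  conv_rhs => rw [← this]
  rw [integral_map hsk.aemeasurable g.continuous.aestronglyMeasurable]

/-- lifts of Bernoulli measures. -/
theorem stmt14 (f₀ f₁ f₂ : ℝ → ℝ) (β₀ lam₀ γ β₂ : ℝ)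
    (h0 : F0cond f₀ β₀ lam₀) (h1 : F1cond f₁ γ lam₀) (h2 : F2cond f₂ β₂ lam₀)
    (hd : ∀ x ∈ Set.Icc (0:ℝ) 1, deriv f₀ x ≤ max β₀ β₂ ∧ deriv f₂ x ≤ max β₀ β₂)
    (p₀ p₁ p₂ : ℝ) (hp0 : 0 ≤ p₀) (hp1 : 0 ≤ p₁) (hp2 : 0 ≤ p₂)
    (hsum : p₀ + p₁ + p₂ = 1)
    (ν : Measure Sig3) (hν : IsBernoulli ![p₀, p₁, p₂] ν) :
    (∃ μ : Measure XSp, IsProbabilityMeasure μ ∧ μ.map (Gmap ![f₀, f₁, f₂]) = μ ∧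
        μ.map Prod.fst = ν ∧ chiOf ![f₀, f₁, f₂] μ ≤ 0) ∧
    (∀ μ : Measure XSp, IsProbabilityMeasure μ → μ.map (Gmap ![f₀, f₁, f₂]) = μ →
        μ.map Prod.fst = ν →
        chiOf ![f₀, f₁, f₂] μ ≤ p₁ * Real.log γ + (p₀ + p₂) * Real.log (max β₀ β₂)) := by
  obtain ⟨a1, a2, a3, a4, a5, a6, a7, a8, a9, a10, a11, a12⟩ := h0
  obtain ⟨b1, b2, b3⟩ := h1
  obtain ⟨c1, c2, c3, c4, c5, c6, c7, -⟩ := h2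
  have hγ : 0 < γ := lt_of_lt_of_le a10 b2
  have hf1 : f₁ = fun x => γ * (1 - x) := funext b1
  have hd1 : ∀ x, deriv f₁ x = -γ := by
    intro x
    rw [hf1]
    have : HasDerivAt (fun x : ℝ => γ * (1 - x)) (γ * (0 - 1)) x :=
      ((hasDerivAt_const x (1:ℝ)).sub (hasDerivAt_id x)).const_mul γ
    rw [this.deriv]; ring
  have hA : ∀ i, ContDiff ℝ 1 ((![f₀, f₁, f₂] : Fin 3 → ℝ → ℝ) i) := by
    intro i
    fin_cases i
    · exact a1
    · change ContDiff ℝ 1 f₁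
      rw [hf1]; fun_prop
    · exact c1
  have hB : ∀ i, Set.MapsTo ((![f₀, f₁, f₂] : Fin 3 → ℝ → ℝ) i) (Set.Icc 0 1) (Set.Icc 0 1) := by
    intro i
    fin_cases i
    · exact a2
    · change Set.MapsTo f₁ _ _
      intro x hx
      rw [b1]
      exact ⟨mul_nonneg hγ.le (by linarith [hx.2]), by nlinarith [hx.1, hx.2]⟩
    · exact c2
  have hC : ∀ i, (∀ x ∈ Set.Icc (0:ℝ) 1, 0 < deriv ((![f₀, f₁, f₂] : Fin 3 → ℝ → ℝ) i) x) ∨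
      (∀ x ∈ Set.Icc (0:ℝ) 1, deriv ((![f₀, f₁, f₂] : Fin 3 → ℝ → ℝ) i) x < 0) := by
    intro i
    fin_cases i
    · left; intro x hx; exact a10.trans_le (a12 x hx)
    · right; intro x hx
      change deriv f₁ x < 0
      rw [hd1]; linarith
    · left; intro x hx; exact a10.trans_le (c7 x hx)
  refine ⟨aux_part1 _ hA hB hC _ ν hν, ?_⟩
  intro μ hμ _ hμν
  have hp : ∀ i, 0 ≤ (![p₀, p₁, p₂] : Fin 3 → ℝ) i := by
    intro i; fin_cases i <;> simpa
  let h : Fin 3 → ℝ := ![Real.log (max β₀ β₂), Real.log γ, Real.log (max β₀ β₂)]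
  have hh : Continuous (fun ξ : Sig3 => h (ξ 0)) :=
    (continuous_of_discreteTopology (f := h)).comp (continuous_apply 0)
  have e := aux_eval_int _ hp ν hν h
  rw [← hμν, integral_map measurable_fst.aemeasurable hh.aestronglyMeasurable] at e
  have key : chiOf ![f₀, f₁, f₂] μ ≤ ∫ q : XSp, h (q.1 0) ∂μ := by
    refine integral_mono (aux_int _ (aux_phi_cont _ hA hC) μ)
      (aux_int _ (hh.comp continuous_fst) μ) fun q => ?_
    have hall : ∀ i : Fin 3, ∀ x ∈ Set.Icc (0:ℝ) 1,
        Real.log |deriv ((![f₀, f₁, f₂] : Fin 3 → ℝ → ℝ) i) x| ≤ h i := by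
      intro i x hx
      fin_cases i
      · change Real.log |deriv f₀ x| ≤ Real.log (max β₀ β₂)
        have := a10.trans_le (a12 x hx)
        rw [abs_of_pos this]
        exact Real.log_le_log this (hd x hx).1
      · change Real.log |deriv f₁ x| ≤ Real.log γ
        rw [hd1, abs_neg, abs_of_pos hγ]
      · change Real.log |deriv f₂ x| ≤ Real.log (max β₀ β₂)
        have := a10.trans_le (c7 x hx)
        rw [abs_of_pos this]
        exact Real.log_le_log this (hd x hx).2
    exact hall _ _ q.2.2
  rw [e, Fin.sum_univ_three] at key
  simp only [h, Matrix.cons_val_zero, Matrix.cons_val_one, Matrix.cons_val] at key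
  linarith

end
end
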